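/- Let F be a field of characteristic p > 2, let α be a partition of n and β a one-box-shift of α with β_a = α_a − 1 and β_b = α_b + 1 for a < b. Then the F-vector space Hom_{FΣ_n}(S^α, S^β) has dimension at most one, and every non-zero FΣ_n-homomorphism S^α → S^β is a scalar multiple of Σ_T ((−1)^{|T|} ∏_{u ∈ {R}∖{T}} h_u) θ̂_T, where the sum runs over all semistandard α-tableaux T of type β. -/

import Mathlib

namespace CarterPayne

open Finset

/-- A partition of `n`, presented by its parts function; rows are indexed from `1`. -/
structure Partition (n : ℕ) where
  parts : ℕ → ℕ
  parts_zero : parts 0 = 0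
  antitone : ∀ ⦃i j : ℕ⦄, 0 < i → i ≤ j → parts j ≤ parts i
  finite_support : (Function.support parts).Finite
  sum_parts : ∑ᶠ i, parts i = n

variable {n : ℕ}

/-- The set of cells `(row, column)` (both 1-indexed) of the Young diagram of `μ`. -/
def Partition.cells (μ : Partition n) : Set (ℕ × ℕ) :=
  {c | 0 < c.1 ∧ 0 < c.2 ∧ c.2 ≤ μ.parts c.1}

/-- A tabloid for the composition `c` of `n`: an assignment of the `n` symbols to rows
(rows indexed from 1), row `i` receiving exactly `c i` symbols. -/
def Tabloid (n : ℕ) (c : ℕ → ℕ) : Type :=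
  {g : Fin n → ℕ // ∀ i, (Finset.univ.filter fun k => g k = i).card = c i}

/-- The permutation module `M^c` over `R`: the free `R`-module on the set of tabloids. -/
abbrev PermMod (R : Type*) [CommRing R] (n : ℕ) (c : ℕ → ℕ) := Tabloid n c →₀ R

/-- The action of a permutation of the symbols on tabloids. -/
def permTabloid (c : ℕ → ℕ) (π : Equiv.Perm (Fin n)) (f : Tabloid n c) : Tabloid n c :=
  ⟨fun k => f.1 (π.symm k), fun i => by
    rw [← f.2 i]
    exact Finset.card_equiv π.symm fun a => by simp⟩

/-- The `R`-linear action of a permutation of the symbols on `M^c`. -/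
noncomputable def permM (R : Type*) [CommRing R] (c : ℕ → ℕ) (π : Equiv.Perm (Fin n)) :
    PermMod R n c →ₗ[R] PermMod R n c :=
  Finsupp.lmapDomain R R (permTabloid c π)

/-- A bijective `μ`-tableau, presented by the placement map which sends each of the
`n` symbols to the cell of the Young diagram containing it. -/
structure Placement (μ : Partition n) where
  pos : Fin n → ℕ × ℕ
  mem : ∀ k, pos k ∈ μ.cells
  inj : Function.Injective pos
  surj : ∀ c ∈ μ.cells, ∃ k, pos k = c

/-- The column stabilizer of a bijective tableau, as a set of permutations of the symbols. -/
def colStab {μ : Partition n} (T : Placement μ) : Finset (Equiv.Perm (Fin n)) :=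
  Finset.univ.filter fun π => ∀ k, (T.pos (π k)).2 = (T.pos k).2

lemma rowFiber_card {μ : Partition n} (T : Placement μ) (i : ℕ) :
    (Finset.univ.filter fun k => (T.pos k).1 = i).card = μ.parts i := by
  classical
  have h : (Finset.univ.filter fun k => (T.pos k).1 = i).card
      = (Finset.Icc 1 (μ.parts i)).card := by
    apply Finset.card_bij (fun k _ => (T.pos k).2)
    · intro a ha
      simp only [Finset.mem_filter, Finset.mem_univ, true_and] at ha
      obtain ⟨h1, h2, h3⟩ := T.mem a
      exact Finset.mem_Icc.mpr ⟨h2, ha ▸ h3⟩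
    · intro a ha b hb hab
      simp only [Finset.mem_filter, Finset.mem_univ, true_and] at ha hb
      exact T.inj (Prod.ext (ha.trans hb.symm) hab)
    · intro j hj
      rw [Finset.mem_Icc] at hj
      have hi0 : 0 < i := by
        rcases Nat.eq_zero_or_pos i with h0 | h0
        · exfalso; rw [h0, μ.parts_zero] at hj; omega
        · exact h0
      obtain ⟨k, hk⟩ := T.surj (i, j) ⟨hi0, hj.1, hj.2⟩
      exact ⟨k, by simp [hk], by simp [hk]⟩
  rw [h, Nat.card_Icc]
  omega

/-- The row tabloid `{tπ}` associated to the bijective tableau `tπ`. -/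
def rowTabloid {μ : Partition n} (T : Placement μ) (π : Equiv.Perm (Fin n)) :
    Tabloid n μ.parts :=
  ⟨fun k => (T.pos (π k)).1, fun i => by
    rw [← rowFiber_card T i]
    exact Finset.card_equiv π fun a => by simp⟩

/-- The polytabloid `e_t` attached to a bijective tableau `t`. -/
noncomputable def polytabloid (R : Type*) [CommRing R] {μ : Partition n} (T : Placement μ) :
    PermMod R n μ.parts :=
  ∑ π ∈ colStab T, ((Equiv.Perm.sign π : ℤ) : R) • Finsupp.single (rowTabloid T π) (1 : R)

/-- The Specht module `S^μ`, the span in `M^μ` of all polytabloids. -/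
noncomputable def Specht (R : Type*) [CommRing R] (μ : Partition n) :
    Submodule R (PermMod R n μ.parts) :=
  Submodule.span R (Set.range fun T : Placement μ => polytabloid R T)

/-- `β` is obtained from the partition `α` of `n` by moving one box from
(the end of) row `a` to (the end of) row `b`; i.e. `β` is a one-box-shift of `α`. -/
structure OneBoxShift {n : ℕ} (α β : Partition n) (a b : ℕ) : Prop where
  a_pos : 0 < a
  a_lt_b : a < b
  rem : α.parts (a + 1) < α.parts a
  add : α.parts b < α.parts (b - 1)
  at_a : β.parts a = α.parts a - 1
  at_b : β.parts b = α.parts b + 1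
  elsewhere : ∀ i, i ≠ a → i ≠ b → β.parts i = α.parts i

/-- The space of `RΣ_n`-homomorphisms from `S^α` to `M^c` whose image lies in the
submodule `target` of `M^c`; an `R`-linear map is an `RΣ_n`-homomorphism when it
intertwines the permutation actions on source and target. -/
noncomputable def SpechtHom (R : Type*) [CommRing R] (α : Partition n) (c : ℕ → ℕ)
    (target : Submodule R (PermMod R n c)) :
    Submodule R (↥(Specht R α) →ₗ[R] PermMod R n c) where
  carrier := {f | (∀ x, f x ∈ target) ∧
    ∀ (π : Equiv.Perm (Fin n)) (x y : ↥(Specht R α)),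
      (x : PermMod R n α.parts) = permM R α.parts π (y : PermMod R n α.parts) →
      f x = permM R c π (f y)}
  add_mem' := by
    rintro f g ⟨hf1, hf2⟩ ⟨hg1, hg2⟩
    refine ⟨fun x => target.add_mem (hf1 x) (hg1 x), fun π x y hxy => ?_⟩
    simp only [LinearMap.add_apply, hf2 π x y hxy, hg2 π x y hxy, map_add]
  zero_mem' :=
    ⟨fun _ => target.zero_mem, fun π x y _ => by simp⟩
  smul_mem' := by
    rintro r f ⟨hf1, hf2⟩
    refine ⟨fun x => target.smul_mem r (hf1 x), fun π x y hxy => ?_⟩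
    simp only [LinearMap.smul_apply, hf2 π x y hxy, map_smul]

-- finiteness of the set of tabloids
lemma tabloid_finite (n : ℕ) (c : ℕ → ℕ) :
    {g : Fin n → ℕ | ∀ i, (Finset.univ.filter fun k => g k = i).card = c i}.Finite := by
  classical
  rcases Set.eq_empty_or_nonempty
      {g : Fin n → ℕ | ∀ i, (Finset.univ.filter fun k => g k = i).card = c i} with h | ⟨g₀, hg₀⟩
  · rw [h]; exact Set.finite_empty
  · apply Set.Finite.subset (Set.Finite.pi fun _ : Fin n => Set.finite_range g₀)
    intro g hg
    simp only [Set.mem_pi, Set.mem_univ, forall_true_left]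
    intro k
    have h1 : (Finset.univ.filter fun k' => g k' = g k).card = c (g k) := hg (g k)
    have h2 : (Finset.univ.filter fun k' => g₀ k' = g k).card = c (g k) := hg₀ (g k)
    have hp : 0 < c (g k) := by
      rw [← h1]
      exact Finset.card_pos.mpr ⟨k, by simp⟩
    rw [← h2] at hp
    obtain ⟨k', hk'⟩ := Finset.card_pos.mp hp
    simp only [Finset.mem_filter] at hk'
    exact ⟨k', hk'.2⟩

noncomputable instance (c : ℕ → ℕ) : Fintype (Tabloid n c) :=
  (tabloid_finite n c).fintype

lemma cells_finite (μ : Partition n) : μ.cells.Finite := by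
  apply Set.Finite.subset (μ.finite_support.prod (Set.finite_Icc 1 (μ.parts 1)))
  rintro ⟨i, j⟩ ⟨h1, h2, h3⟩
  refine Set.mem_prod.mpr ⟨?_, ?_⟩
  · simp only [Function.mem_support]
    intro h0
    rw [h0] at h3; omega
  · exact ⟨h2, le_trans h3 (μ.antitone Nat.one_pos h1)⟩

/-- The finset of cells of the Young diagram of `μ`. -/
noncomputable def cellFinset (μ : Partition n) : Finset (ℕ × ℕ) := (cells_finite μ).toFinset

/-- An `α`-tableau (a filling of the diagram of `α` by natural numbers) has type `c`
if the entry `j` appears exactly `c j` times. -/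
def IsTypeOf (α : Partition n) (c : ℕ → ℕ) (T : ℕ × ℕ → ℕ) : Prop :=
  ∀ j, ((cellFinset α).filter fun cc => T cc = j).card = c j

/-- A filling of the diagram of `α` is semistandard if its entries are nondecreasing
along rows and strictly increasing down columns. -/
def IsSemistandard (α : Partition n) (T : ℕ × ℕ → ℕ) : Prop :=
  (∀ i j j', (i, j) ∈ α.cells → (i, j') ∈ α.cells → j ≤ j' → T (i, j) ≤ T (i, j')) ∧
  (∀ i i' j, (i, j) ∈ α.cells → (i', j) ∈ α.cells → i < i' → T (i, j) < T (i', j))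

/-- Number of entries equal to `j` in row `i` of the `α`-tableau `T`. -/
def rowContent (α : Partition n) (T : ℕ × ℕ → ℕ) (i j : ℕ) : ℕ :=
  ((Finset.Icc 1 (α.parts i)).filter fun col => T (i, col) = j).card

open Classical in
/-- James' homomorphism `θ_T : M^α → M^c` attached to an `α`-tableau `T` of type `c`:
an `α`-tabloid `f` is sent to the sum of all `c`-tabloids `g` such that, for all `i`, `j`,
exactly `rowContent α T i j` symbols lie in row `i` of `f` and row `j` of `g`.  (This is
the sum over the row-equivalence class of `T` of the corresponding tabloids.) -/
noncomputable def theta (R : Type*) [CommRing R] (α : Partition n) (c : ℕ → ℕ)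
    (T : ℕ × ℕ → ℕ) : PermMod R n α.parts →ₗ[R] PermMod R n c :=
  Finsupp.lift (PermMod R n c) R (Tabloid n α.parts) fun f =>
    ∑ g ∈ Finset.univ.filter (fun g : Tabloid n c =>
        ∀ i j, (Finset.univ.filter fun k => f.1 k = i ∧ g.1 k = j).card = rowContent α T i j),
      Finsupp.single g (1 : R)

/-- The restriction `θ̂_T` of `θ_T` to the Specht module `S^α`. -/
noncomputable def thetaHat (R : Type*) [CommRing R] (α : Partition n) (c : ℕ → ℕ)
    (T : ℕ × ℕ → ℕ) : ↥(Specht R α) →ₗ[R] PermMod R n c :=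
  (theta R α c T).comp (Specht R α).subtype

/-- The composition `ν` obtained from `c` by replacing the rows `i`, `i+1` with rows of
sizes `c i + c (i+1) - r` and `r`. -/
def nuComp (c : ℕ → ℕ) (i r : ℕ) : ℕ → ℕ :=
  fun j => if j = i then c i + c (i + 1) - r else if j = i + 1 then r else c j

open Classical in
/-- James' homomorphism `ψ_{i,r} : M^c → M^ν`: a tabloid is sent to the sum of all
tabloids obtained from it by changing all but `r` of the entries in row `i+1` to `i`. -/
noncomputable def psi (R : Type*) [CommRing R] (c : ℕ → ℕ) (i r : ℕ) :
    PermMod R n c →ₗ[R] PermMod R n (nuComp c i r) :=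
  Finsupp.lift (PermMod R n (nuComp c i r)) R (Tabloid n c) fun f =>
    ∑ g ∈ Finset.univ.filter (fun g : Tabloid n (nuComp c i r) =>
        ∀ k, g.1 k = f.1 k ∨ (f.1 k = i + 1 ∧ g.1 k = i)),
      Finsupp.single g (1 : R)

/-- Normalized semistandard `α`-tableaux of type `c` (entries outside the diagram are `0`). -/
def SSTSet (α : Partition n) (c : ℕ → ℕ) : Set (ℕ × ℕ → ℕ) :=
  {T | IsSemistandard α T ∧ IsTypeOf α c T ∧ ∀ cc, cc ∉ α.cells → T cc = 0}

lemma SSTSet_finite (α : Partition n) (c : ℕ → ℕ) (hc : (Function.support c).Finite) :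
    (SSTSet α c).Finite := by
  classical
  have hinj : Set.InjOn (fun T (cc : ↥(cellFinset α)) => T cc.1) (SSTSet α c) := by
    intro T hT S hS h
    funext cc
    by_cases hcc : cc ∈ α.cells
    · have hmem : cc ∈ cellFinset α := (Set.Finite.mem_toFinset _).mpr hcc
      exact congrFun h ⟨cc, hmem⟩
    · rw [hT.2.2 cc hcc, hS.2.2 cc hcc]
  have himage : ((fun T (cc : ↥(cellFinset α)) => T cc.1) '' SSTSet α c) ⊆
      Set.univ.pi (fun _ : ↥(cellFinset α) => insert 0 (Function.support c)) := by
    rintro _ ⟨T, hT, rfl⟩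
    intro cc _
    have h1 := hT.2.1 (T cc.1)
    have h2 : cc.1 ∈ (cellFinset α).filter fun d => T d = T cc.1 :=
      Finset.mem_filter.mpr ⟨cc.2, rfl⟩
    have h3 : 0 < c (T cc.1) := h1 ▸ Finset.card_pos.mpr ⟨cc.1, h2⟩
    exact Set.mem_insert_iff.mpr (Or.inr (by
      simp only [Function.mem_support]
      omega))
  exact Set.Finite.of_finite_image
    (Set.Finite.subset (Set.Finite.pi fun _ => hc.insert 0) himage) hinj

/-- The finset of all (normalized) semistandard `α`-tableaux of type `β`. -/
noncomputable def sstFinset (α β : Partition n) : Finset (ℕ × ℕ → ℕ) :=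
  (SSTSet_finite α β.parts β.finite_support).toFinset

/-- `T̂(u)`, the entry at the end of row `u` of `T`. -/
def hatOf (α : Partition n) (T : ℕ × ℕ → ℕ) (u : ℕ) : ℕ := T (u, α.parts u)

/-- The semistandard `α`-set `{T}` of `T`: those rows `u ∈ {a, …, b-1}` with `T̂(u) ≠ u`. -/
def Tset (α : Partition n) (a b : ℕ) (T : ℕ × ℕ → ℕ) : Finset ℕ :=
  (Finset.Icc a (b - 1)).filter fun u => hatOf α T u ≠ u

/-- The removable set `{R}`: those rows `i ∈ {a, …, b-1}` such that `(i, α_i)` is a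
removable node of `[α]`. -/
def Rset (α : Partition n) (a b : ℕ) : Finset ℕ :=
  (Finset.Icc a (b - 1)).filter fun i => α.parts (i + 1) < α.parts i

/-- The hook lengths `h_i` in the `(α_b + 1)`-th column of `[α]` (with `h_i = 0` for `i ≥ b`):
`h_i = α_i - α_b + b - i - 1`. -/
def hook (α : Partition n) (b i : ℕ) : ℤ :=
  if i < b then (α.parts i : ℤ) - (α.parts b : ℤ) + (b : ℤ) - (i : ℤ) - 1 else 0

/-- `T̂⁻¹(v)`: the row `u ∈ {a, …, b-1}` with `T̂(u) = v`. -/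
noncomputable def invHat (α : Partition n) (a b : ℕ) (T : ℕ × ℕ → ℕ) (v : ℕ) : ℕ :=
  sInf {u | a ≤ u ∧ u ≤ b - 1 ∧ hatOf α T u = v}

/-- The smallest element of `X` greater than `u`, or `b` if there is none. -/
noncomputable def nextIn (X : Finset ℕ) (b u : ℕ) : ℕ := sInf ({v | v ∈ X ∧ u < v} ∪ {b})

/-- The bijection `T̂ : {a,…,b-1} → {a+1,…,b}` determined by a semistandard set `X`:
`T̂` maps each `u ∈ X` to the next element of `X ∪ {b}` above it, and fixes `u ∉ X`. -/
noncomputable def hatOfSet (X : Finset ℕ) (b u : ℕ) : ℕ :=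
  if u ∈ X then nextIn X b u else u

open Classical in
/-- The (normalized) semistandard `α`-tableau of type `β` whose semistandard set is `X`:
every cell of row `i` contains `i`, except that for `a ≤ i ≤ b-1` the last cell of row `i`
contains `T̂(i)` (where `T̂` is the bijection determined by `X`). -/
noncomputable def tableauOfSet (α : Partition n) (a b : ℕ) (X : Finset ℕ) : ℕ × ℕ → ℕ :=
  fun cc =>
    if cc ∈ α.cells then
      (if a ≤ cc.1 ∧ cc.1 ≤ b - 1 ∧ cc.2 = α.parts cc.1 then hatOfSet X b cc.1 else cc.1)
    else 0

/-- `X` is a semistandard `α`-set of type `β` (for the one-box shift from row `a` to row `b`):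
`a ∈ X ⊆ {a, …, b-1}`, and `u ∈ X` together with `α_{u+1} = α_u` forces `u+1 ∈ X`. -/
def IsSSSet (α : Partition n) (a b : ℕ) (X : Finset ℕ) : Prop :=
  a ∈ X ∧ (∀ u ∈ X, a ≤ u ∧ u ≤ b - 1) ∧
    ∀ u ∈ X, α.parts (u + 1) = α.parts u → u + 1 ∈ X

/-- The coefficient `(-1)^{|T|} ∏_{u ∈ {R}\{T}} h_u` of `θ̂_T` in the Carter-Payne
homomorphism. -/
noncomputable def cpCoeff (α : Partition n) (a b : ℕ) (T : ℕ × ℕ → ℕ) : ℤ :=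
  (-1) ^ (Tset α a b T).card * ∏ u ∈ Rset α a b \ Tset α a b T, hook α b u

section RepresentationFacts

/-- Constructor for tabloids. -/
def mkTab {c : ℕ → ℕ} (g : Fin n → ℕ)
    (h : ∀ i, (Finset.univ.filter fun k => g k = i).card = c i) : Tabloid n c := ⟨g, h⟩

open Classical in
/-- Coefficient of an arbitrary word in an element of the permutation module. -/
noncomputable def val {F : Type*} [CommRing F] {c : ℕ → ℕ} (v : PermMod F n c)
    (g : Fin n → ℕ) : F :=
  if h : ∀ i, (Finset.univ.filter fun k => g k = i).card = c i then v (mkTab g h) else 0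

variable {F : Type*} [CommRing F] {c : ℕ → ℕ}

lemma val_ext {v w : PermMod F n c} (h : ∀ g, val v g = val w g) : v = w := by
  refine Finsupp.ext fun x => ?_
  have := h x.1
  simp only [val, dif_pos x.2] at this
  exact this

@[simp] lemma val_zero (g : Fin n → ℕ) : val (0 : PermMod F n c) g = 0 := by
  simp [val]

@[simp] lemma val_add (v w : PermMod F n c) (g : Fin n → ℕ) :
    val (v + w) g = val v g + val w g := by
  unfold val; split_ifs <;> simp

@[simp] lemma val_smul (r : F) (v : PermMod F n c) (g : Fin n → ℕ) :
    val (r • v) g = r * val v g := by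
  unfold val; split_ifs <;> simp

lemma val_sum {ι : Type*} (s : Finset ι) (v : ι → PermMod F n c) (g : Fin n → ℕ) :
    val (∑ i ∈ s, v i) g = ∑ i ∈ s, val (v i) g := by
  classical
  induction s using Finset.induction_on with
  | empty => simp
  | insert a s ha ih => rw [Finset.sum_insert ha, Finset.sum_insert ha, val_add, ih]

open Classical in
lemma val_single (x : Tabloid n c) (g : Fin n → ℕ) :
    val (Finsupp.single x (1 : F)) g = if g = x.1 then 1 else 0 := by
  unfold val
  split_ifs with h h2 h2
  · have h3 : x = mkTab g h := Subtype.ext h2.symm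
    rw [h3, Finsupp.single_eq_same]
  · rw [Finsupp.single_apply, if_neg]
    intro h3; apply h2; rw [h3]; rfl
  · subst h2; exact absurd x.2 h
  · rfl

lemma content_perm (g : Fin n → ℕ) (π : Equiv.Perm (Fin n)) (i : ℕ) :
    (Finset.univ.filter fun k => (g ∘ π) k = i).card
      = (Finset.univ.filter fun k => g k = i).card :=
  Finset.card_equiv π fun a => by simp

lemma val_permM (π : Equiv.Perm (Fin n)) (v : PermMod F n c) (g : Fin n → ℕ) :
    val (permM F c π v) g = val v (g ∘ π) := by
  classical
  induction v using Finsupp.induction_linear with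
  | zero => simp
  | add v w hv hw => simp [hv, hw]
  | single x r =>
    have h1 : Finsupp.single x r = r • Finsupp.single x (1 : F) := by simp
    rw [h1, map_smul, val_smul, val_smul]
    congr 1
    unfold permM
    rw [Finsupp.lmapDomain_apply, Finsupp.mapDomain_single, val_single, val_single]
    congr 1
    refine propext ⟨?_, ?_⟩
    · rintro rfl; funext k; simp [permTabloid]
    · intro h; funext k; simp [permTabloid, ← h]

open Classical in
lemma val_polytabloid {μ : Partition n} (T : Placement μ) (g : Fin n → ℕ) :
    val (polytabloid F T) g
      = ∑ π ∈ colStab T, if g = (fun k => (T.pos (π k)).1) then ((Equiv.Perm.sign π : ℤ) : F) else 0 := by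
  unfold polytabloid
  rw [val_sum]
  refine Finset.sum_congr rfl fun π _ => ?_
  rw [val_smul, val_single]
  change ((Equiv.Perm.sign π : ℤ) : F) * (if g = (fun k => (T.pos (π k)).1) then 1 else 0) = _
  rw [mul_ite, mul_one, mul_zero]

lemma mem_colStab {μ : Partition n} {T : Placement μ} {π : Equiv.Perm (Fin n)} :
    π ∈ colStab T ↔ ∀ k, (T.pos (π k)).2 = (T.pos k).2 := by
  simp [colStab]

lemma val_polytabloid_alt {μ : Partition n} (T : Placement μ) (g : Fin n → ℕ)
    {σ : Equiv.Perm (Fin n)} (hσ : σ ∈ colStab T) :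
    val (polytabloid F T) (g ∘ σ) = ((Equiv.Perm.sign σ : ℤ) : F) * val (polytabloid F T) g := by
  classical
  rw [val_polytabloid, val_polytabloid, Finset.mul_sum]
  symm
  rw [mem_colStab] at hσ
  refine Finset.sum_bij' (fun π _ => π * σ) (fun π _ => π * σ⁻¹) ?_ ?_ ?_ ?_ ?_
  · intro π hπ
    rw [mem_colStab] at hπ ⊢
    intro k; simp [hπ, hσ]
  · intro π hπ
    rw [mem_colStab] at hπ ⊢
    intro k
    have := hσ (σ⁻¹ k)
    rw [show σ (σ⁻¹ k) = k by simp] at this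
    simp [hπ, this]
  · intro π _; simp
  · intro π _; simp
  · intro π _
    have : (g = fun k => (T.pos (π k)).1) ↔ (g ∘ σ = fun k => (T.pos ((π * σ) k)).1) := by
      constructor
      · rintro rfl; funext k; simp
      · intro h; funext k
        have := congrFun h (σ⁻¹ k)
        simpa using this
    by_cases h : g = fun k => (T.pos (π k)).1
    · rw [if_pos h, if_pos (this.1 h)]
      rw [Equiv.Perm.sign_mul]; push_cast; ring
    · rw [if_neg h, if_neg (fun h' => h (this.2 h'))]; simp

lemma val_polytabloid_swap {μ : Partition n} (T : Placement μ) (g : Fin n → ℕ)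
    {k l : Fin n} (hkl : k ≠ l) (hc : (T.pos k).2 = (T.pos l).2) :
    val (polytabloid F T) (g ∘ Equiv.swap k l) = - val (polytabloid F T) g := by
  rw [val_polytabloid_alt, Equiv.Perm.sign_swap hkl]
  · simp
  · rw [mem_colStab]; intro m
    rcases Equiv.swap_apply_eq_iff.mp (rfl : Equiv.swap k l m = Equiv.swap k l m) with _
    by_cases h1 : m = k
    · subst h1; simp [hc]
    · by_cases h2 : m = l
      · subst h2; simp [hc]
      · rw [Equiv.swap_apply_of_ne_of_ne h1 h2]

lemma val_polytabloid_ne_zero {μ : Partition n} (T : Placement μ) (g : Fin n → ℕ)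
    (h : val (polytabloid F T) g ≠ 0) :
    ∃ π : Equiv.Perm (Fin n), (∀ k, (T.pos (π k)).2 = (T.pos k).2) ∧
      ∀ k, g k = (T.pos (π k)).1 := by
  classical
  rw [val_polytabloid] at h
  obtain ⟨π, hπ, h2⟩ := Finset.exists_ne_zero_of_sum_ne_zero h
  refine ⟨π, mem_colStab.1 hπ, ?_⟩
  by_contra h3
  apply h2
  rw [if_neg]
  intro h4; apply h3; intro k; rw [h4]

lemma val_polytabloid_inj {μ : Partition n} (T : Placement μ) (g : Fin n → ℕ)
    (h : val (polytabloid F T) g ≠ 0) {k l : Fin n} (hc : (T.pos k).2 = (T.pos l).2)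
    (hg : g k = g l) : k = l := by
  obtain ⟨π, h1, h2⟩ := val_polytabloid_ne_zero T g h
  apply π.injective
  apply T.inj
  apply Prod.ext
  · rw [← h2, ← h2, hg]
  · rw [h1, h1, hc]

/-- The raising operators kill polytabloids. -/
lemma val_polytabloid_raise {μ : Partition n} (T : Placement μ) (B : Fin n → ℕ) {i j : ℕ}
    (hi : 0 < i) (hij : i < j) :
    ∑ k ∈ Finset.univ.filter (fun k => B k = i),
      val (polytabloid F T) (Function.update B k j) = 0 := by
  classical
  -- partner of `k`
  have key : ∀ k, B k = i → val (polytabloid F T) (Function.update B k j) ≠ 0 →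
      ∃ l, l ≠ k ∧ B l = i ∧ (T.pos l).2 = (T.pos k).2 := by
    intro k hk hne
    obtain ⟨π, h1, h2⟩ := val_polytabloid_ne_zero T _ hne
    have hj : (T.pos (π k)).1 = j := by rw [← h2]; simp
    obtain ⟨m1, m2, m3⟩ := T.mem (π k)
    have hcell : (i, (T.pos k).2) ∈ μ.cells := by
      refine ⟨hi, ?_, ?_⟩
      · rw [← h1]; exact m2
      · rw [← h1]
        refine le_trans m3 (μ.antitone hi ?_)
        rw [hj]; exact hij.le
    obtain ⟨m, hm⟩ := T.surj _ hcell
    have hl := h2 (π.symm m)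
    have hcol := h1 (π.symm m)
    rw [Equiv.apply_symm_apply, hm] at hl hcol
    have hlk : π.symm m ≠ k := by
      intro h
      rw [h, Function.update_self] at hl
      simp at hl
      omega
    rw [Function.update_of_ne hlk] at hl
    exact ⟨_, hlk, hl, hcol.symm⟩
  have key2 : ∀ k l, B k = i → l ≠ k → B l = i → (T.pos l).2 = (T.pos k).2 →
      val (polytabloid F T) (Function.update B l j)
        = - val (polytabloid F T) (Function.update B k j) := by
    intro k l hk hlk hl hc
    rw [← val_polytabloid_swap T _ hlk hc]
    congr 1
    funext m
    simp only [Function.comp_apply]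
    by_cases h1 : m = l
    · subst h1; simp
    · by_cases h2 : m = k
      · subst h2
        simp [h1, hlk, hk, hl]
      · rw [Equiv.swap_apply_of_ne_of_ne h1 h2, Function.update_of_ne h1, Function.update_of_ne h2]
  have uniq : ∀ k l l', B k = i → l ≠ k → B l = i → (T.pos l).2 = (T.pos k).2 →
      l' ≠ k → B l' = i → (T.pos l').2 = (T.pos k).2 →
      val (polytabloid F T) (Function.update B k j) ≠ 0 → l = l' := by
    intro k l l' hk h1 h2 h3 h4 h5 h6 hne
    apply val_polytabloid_inj T _ hne (h3.trans h6.symm)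
    rw [Function.update_of_ne h1, Function.update_of_ne h4, h2, h5]
  let inv : Fin n → Fin n := fun k =>
    if h : ∃ l, l ≠ k ∧ B l = i ∧ (T.pos l).2 = (T.pos k).2 then h.choose else k
  have inv_spec : ∀ k, B k = i → val (polytabloid F T) (Function.update B k j) ≠ 0 →
      inv k ≠ k ∧ B (inv k) = i ∧ (T.pos (inv k)).2 = (T.pos k).2 := by
    intro k hk hne
    have h := key k hk hne
    have : inv k = h.choose := dif_pos h
    rw [this]; exact h.choose_spec
  rw [← Finset.sum_filter_ne_zero]
  refine Finset.sum_involution (fun k _ => inv k) ?_ ?_ ?_ ?_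
  · intro k hk
    simp only [Finset.mem_filter, Finset.mem_univ, true_and] at hk
    obtain ⟨h1, h2, h3⟩ := inv_spec k hk.1 hk.2
    rw [key2 k (inv k) hk.1 h1 h2 h3]; simp
  · intro k hk _
    simp only [Finset.mem_filter, Finset.mem_univ, true_and] at hk
    exact (inv_spec k hk.1 hk.2).1
  · intro k hk
    simp only [Finset.mem_filter, Finset.mem_univ, true_and] at hk ⊢
    obtain ⟨h1, h2, h3⟩ := inv_spec k hk.1 hk.2
    refine ⟨h2, ?_⟩
    rw [key2 k (inv k) hk.1 h1 h2 h3]; simpa using hk.2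
  · intro k hk
    simp only [Finset.mem_filter, Finset.mem_univ, true_and] at hk
    obtain ⟨h1, h2, h3⟩ := inv_spec k hk.1 hk.2
    have hne : val (polytabloid F T) (Function.update B (inv k) j) ≠ 0 := by
      rw [key2 k (inv k) hk.1 h1 h2 h3]; simpa using hk.2
    obtain ⟨h4, h5, h6⟩ := inv_spec _ h2 hne
    exact uniq (inv k) _ _ h2 h4 h5 h6 h1.symm hk.1 h3.symm hne

/-- The one-element Garnir relation. -/
lemma val_polytabloid_garnir {μ : Partition n} (T : Placement μ) (g : Fin n → ℕ)
    (z : Fin n) {C : ℕ} (hC0 : 0 < C) (hC : C < (T.pos z).2) :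
    val (polytabloid F T) g = ∑ y ∈ Finset.univ.filter (fun y => (T.pos y).2 = C),
      val (polytabloid F T) (g ∘ Equiv.swap z y) := by
  classical
  set e := val (polytabloid F T) with he
  have hzy : ∀ y, (T.pos y).2 = C → y ≠ z := by
    rintro y hy rfl; omega
  -- value at z of a supported word lies among the rows of column C
  have hit : ∀ g', e g' ≠ 0 → ∃ y, (T.pos y).2 = C ∧ g' y = g' z := by
    intro g' hne
    obtain ⟨π, h1, h2⟩ := val_polytabloid_ne_zero T _ hne
    obtain ⟨m1, m2, m3⟩ := T.mem (π z)
    have hcell : ((T.pos (π z)).1, C) ∈ μ.cells := by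
      refine ⟨m1, hC0, ?_⟩
      have := h1 z
      simp only at m3 ⊢
      omega
    obtain ⟨m, hm⟩ := T.surj _ hcell
    refine ⟨π.symm m, ?_, ?_⟩
    · have := h1 (π.symm m)
      rw [Equiv.apply_symm_apply, hm] at this
      exact this.symm
    · rw [h2, h2, Equiv.apply_symm_apply, hm]
  have inj : ∀ g', e g' ≠ 0 → ∀ k l, (T.pos k).2 = C → (T.pos l).2 = C → g' k = g' l → k = l := by
    intro g' hne k l hk hl h
    exact val_polytabloid_inj T g' hne (hk.trans hl.symm) h
  by_cases hg : e g = 0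
  · rw [hg]; symm
    by_contra hsum
    obtain ⟨y1, hy1, hne1⟩ := Finset.exists_ne_zero_of_sum_ne_zero hsum
    simp only [Finset.mem_filter, Finset.mem_univ, true_and] at hy1
    obtain ⟨y2, hy2, h2⟩ := hit _ hne1
    have hz1 := hzy y1 hy1
    have hz2 := hzy y2 hy2
    have h12 : y1 ≠ y2 := by
      rintro rfl
      simp only [Function.comp_apply, Equiv.swap_apply_right, Equiv.swap_apply_left] at h2
      apply hne1
      have : g ∘ Equiv.swap z y1 = g := by
        funext m
        simp only [Function.comp_apply]
        by_cases ha : m = z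
        · subst ha; simp [h2]
        · by_cases hb : m = y1
          · subst hb; simp [h2]
          · rw [Equiv.swap_apply_of_ne_of_ne ha hb]
      rw [this]; exact hg
    have h2' : g y2 = g y1 := by
      simpa [Equiv.swap_apply_of_ne_of_ne hz2 h12.symm] using h2
    apply hsum
    have hsub : ({y1, y2} : Finset (Fin n)) ⊆ Finset.univ.filter (fun y => (T.pos y).2 = C) := by
      intro y hy
      simp only [Finset.mem_insert, Finset.mem_singleton] at hy
      rcases hy with rfl | rfl <;> simp [hy1, hy2]
    rw [← Finset.sum_subset hsub, Finset.sum_pair h12]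
    · have : g ∘ Equiv.swap z y2 = (g ∘ Equiv.swap z y1) ∘ Equiv.swap y1 y2 := by
        funext m
        simp only [Function.comp_apply]
        by_cases ha : m = z
        · subst ha
          rw [Equiv.swap_apply_of_ne_of_ne hz1.symm hz2.symm]; simp [h2']
        · by_cases hb : m = y1
          · subst hb
            rw [Equiv.swap_apply_of_ne_of_ne ha h12]
            simp only [Equiv.swap_apply_left]
            rw [Equiv.swap_apply_of_ne_of_ne hz2 h12.symm, h2']
          · by_cases hd : m = y2
            · subst hd; simp
            · rw [Equiv.swap_apply_of_ne_of_ne ha hd, Equiv.swap_apply_of_ne_of_ne hb hd,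
                Equiv.swap_apply_of_ne_of_ne ha hb]
      rw [this, he, val_polytabloid_swap T _ h12 (hy1.trans hy2.symm)]; simp
    · intro y hy hy'
      simp only [Finset.mem_filter, Finset.mem_univ, true_and] at hy
      simp only [Finset.mem_insert, Finset.mem_singleton, not_or] at hy'
      by_contra hne
      apply h12
      apply inj _ hne y1 y2 hy1 hy2
      simp only [Function.comp_apply]
      rw [Equiv.swap_apply_of_ne_of_ne hz1 (Ne.symm hy'.1),
        Equiv.swap_apply_of_ne_of_ne hz2 (Ne.symm hy'.2), h2']
  · obtain ⟨y0, hy0, h0⟩ := hit g hg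
    have hz0 := hzy y0 hy0
    rw [Finset.sum_eq_single_of_mem y0 (by simp [hy0])]
    · congr 1
      funext m
      simp only [Function.comp_apply]
      by_cases ha : m = z
      · subst ha; simp [h0]
      · by_cases hb : m = y0
        · subst hb; simp [h0]
        · rw [Equiv.swap_apply_of_ne_of_ne ha hb]
    · intro y hy hne
      simp only [Finset.mem_filter, Finset.mem_univ, true_and] at hy
      by_contra hne2
      apply hne
      apply inj _ hne2 y y0 hy hy0
      simp only [Function.comp_apply, Equiv.swap_apply_right]
      rw [Equiv.swap_apply_of_ne_of_ne hz0 (Ne.symm hne), h0]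

/-- Relabelling a bijective tableau. -/
def Placement.perm {μ : Partition n} (T : Placement μ) (π : Equiv.Perm (Fin n)) : Placement μ where
  pos := fun k => T.pos (π.symm k)
  mem := fun k => T.mem _
  inj := T.inj.comp π.symm.injective
  surj := fun c hc => by
    obtain ⟨k, hk⟩ := T.surj c hc
    exact ⟨π k, by simp [hk]⟩

lemma permM_polytabloid {μ : Partition n} (T : Placement μ) (π : Equiv.Perm (Fin n)) :
    permM F μ.parts π (polytabloid F T) = polytabloid F (T.perm π) := by
  classical
  apply val_ext
  intro g
  rw [val_permM, val_polytabloid, val_polytabloid]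
  refine Finset.sum_bij' (fun σ _ => π * σ * π⁻¹) (fun σ _ => π⁻¹ * σ * π) ?_ ?_ ?_ ?_ ?_
  · intro σ hσ
    rw [mem_colStab] at hσ ⊢
    intro k
    simp [Placement.perm, hσ]
  · intro σ hσ
    rw [mem_colStab] at hσ ⊢
    intro k
    have := hσ (π k)
    simpa [Placement.perm] using this
  · intro σ _; group
  · intro σ _; group
  · intro σ _
    have h1 : (g ∘ π = fun k => (T.pos (σ k)).1) ↔
        (g = fun k => ((T.perm π).pos ((π * σ * π⁻¹) k)).1) := by
      constructor
      · intro h; funext k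
        have := congrFun h (π⁻¹ k)
        simpa [Placement.perm] using this
      · rintro rfl; funext k
        simp [Placement.perm]
    have h2 : Equiv.Perm.sign (π * σ * π⁻¹) = Equiv.Perm.sign σ := by
      rw [Equiv.Perm.sign_mul, Equiv.Perm.sign_mul, mul_comm, ← mul_assoc, ← Equiv.Perm.sign_mul]
      simp
    rw [h2]
    by_cases h : g ∘ π = fun k => (T.pos (σ k)).1
    · rw [if_pos h, if_pos (h1.1 h)]
    · rw [if_neg h, if_neg (fun h' => h (h1.2 h'))]

lemma exists_perm {μ : Partition n} (T T' : Placement μ) :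
    ∃ π : Equiv.Perm (Fin n), T' = T.perm π := by
  classical
  choose s hs using fun k => T.surj _ (T'.mem k)
  have hinj : Function.Injective s := by
    intro k l h
    apply T'.inj
    rw [← hs, ← hs, h]
  let σ : Equiv.Perm (Fin n) := Equiv.ofBijective s (Finite.injective_iff_bijective.1 hinj)
  refine ⟨σ.symm, ?_⟩
  cases T'
  simp only [Placement.perm, Placement.mk.injEq]
  funext k
  exact (hs k).symm

end RepresentationFacts

section GoodFunctions

/-- Properties of the coefficient function of the image of a polytabloid, read as a function
of fillings of the diagram. -/
structure GoodW {F : Type*} [Field F] (α : Partition n) (c : ℕ → ℕ)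
    (W : (ℕ × ℕ → ℕ) → F) : Prop where
  congr : ∀ A A' : ℕ × ℕ → ℕ, (∀ p ∈ α.cells, A p = A' p) → W A = W A'
  swap : ∀ (A : ℕ × ℕ → ℕ) (p q : ℕ × ℕ), p ∈ α.cells → q ∈ α.cells → p ≠ q → p.2 = q.2 →
    W (A ∘ Equiv.swap p q) = - W A
  rep : ∀ (A : ℕ × ℕ → ℕ) (p q : ℕ × ℕ), p ∈ α.cells → q ∈ α.cells → p ≠ q → p.2 = q.2 →
    A p = A q → W A = 0
  perm : ∀ (A A' : ℕ × ℕ → ℕ) (s : ℕ × ℕ → ℕ × ℕ), (∀ p ∈ α.cells, s p ∈ α.cells ∧ (s p).2 = p.2) →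
    Set.InjOn s α.cells → (∀ p ∈ α.cells, A' p = A (s p)) → W A = 0 → W A' = 0
  garnir : ∀ (A : ℕ × ℕ → ℕ) (z : ℕ × ℕ) (C : ℕ), z ∈ α.cells → 0 < C → C < z.2 →
    W A = ∑ q ∈ (cellFinset α).filter (fun q => q.2 = C), W (A ∘ Equiv.swap z q)
  content : ∀ A : ℕ × ℕ → ℕ, W A ≠ 0 → IsTypeOf α c A

/-- Annihilation by the raising operators. -/
def RaiseW {F : Type*} [Field F] (α : Partition n) (W : (ℕ × ℕ → ℕ) → F) : Prop :=
  ∀ (B : ℕ × ℕ → ℕ) (i j : ℕ), 0 < i → i < j →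
    ∑ p ∈ (cellFinset α).filter (fun p => B p = i), W (Function.update B p j) = 0

lemma mem_cellFinset {α : Partition n} {p : ℕ × ℕ} : p ∈ cellFinset α ↔ p ∈ α.cells := by
  simp [cellFinset]

variable {F : Type*} [Field F] {α : Partition n}

lemma swap_comp_pos (t : Placement α) (k l m : Fin n) :
    Equiv.swap (t.pos k) (t.pos l) (t.pos m) = t.pos (Equiv.swap k l m) := by
  by_cases h1 : m = k
  · subst h1; simp
  · by_cases h2 : m = l
    · subst h2; simp
    · rw [Equiv.swap_apply_of_ne_of_ne h1 h2,
        Equiv.swap_apply_of_ne_of_ne (fun h => h1 (t.inj h)) (fun h => h2 (t.inj h))]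

lemma sum_cells (t : Placement α) {M : Type*} [AddCommMonoid M] (P : ℕ × ℕ → Prop)
    [DecidablePred P] (φ : ℕ × ℕ → M) :
    ∑ p ∈ (cellFinset α).filter P, φ p
      = ∑ k ∈ Finset.univ.filter (fun k => P (t.pos k)), φ (t.pos k) := by
  symm
  refine Finset.sum_bij (fun k _ => t.pos k) ?_ ?_ ?_ ?_
  · intro k hk
    simp only [Finset.mem_filter, Finset.mem_univ, true_and] at hk
    simp [mem_cellFinset, t.mem, hk]
  · intro k _ l _ h; exact t.inj h
  · intro p hp
    simp only [Finset.mem_filter, mem_cellFinset] at hp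
    obtain ⟨k, rfl⟩ := t.surj p hp.1
    exact ⟨k, by simp [hp.2], rfl⟩
  · intro k _; rfl

lemma card_cells (t : Placement α) (P : ℕ × ℕ → Prop) [DecidablePred P] :
    ((cellFinset α).filter P).card = (Finset.univ.filter (fun k => P (t.pos k))).card := by
  rw [Finset.card_eq_sum_ones, Finset.card_eq_sum_ones, sum_cells t]

/-- The polytabloid as an element of the Specht module. -/
noncomputable def poly (F : Type*) [Field F] (t : Placement α) : ↥(Specht F α) :=
  ⟨polytabloid F t, Submodule.subset_span ⟨t, rfl⟩⟩

variable {c : ℕ → ℕ}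

/-- The coefficient function of `f e_t`. -/
noncomputable def Wof (t : Placement α) (f : ↥(Specht F α) →ₗ[F] PermMod F n c)
    (A : ℕ × ℕ → ℕ) : F := val (f (poly F t)) (fun k => A (t.pos k))

lemma hom_perm {tg : Submodule F (PermMod F n c)} {f : ↥(Specht F α) →ₗ[F] PermMod F n c}
    (hf : f ∈ SpechtHom F α c tg) (t : Placement α) (π : Equiv.Perm (Fin n)) :
    f (poly F (t.perm π)) = permM F c π (f (poly F t)) :=
  hf.2 π _ _ (permM_polytabloid t π).symm

lemma goodW_of_hom (h2 : (2 : F) ≠ 0) {tg : Submodule F (PermMod F n c)}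
    {f : ↥(Specht F α) →ₗ[F] PermMod F n c}
    (hf : f ∈ SpechtHom F α c tg) (t : Placement α) : GoodW α c (Wof t f) := by
  classical
  have alt : ∀ (g : Fin n → ℕ) (σ : Equiv.Perm (Fin n)), σ ∈ colStab t →
      val (f (poly F t)) (g ∘ σ) = ((Equiv.Perm.sign σ : ℤ) : F) * val (f (poly F t)) g := by
    intro g σ hσ
    have h1 : poly F (t.perm σ) = ((Equiv.Perm.sign σ : ℤ) : F) • poly F t := by
      apply Subtype.ext
      change polytabloid F (t.perm σ) = ((Equiv.Perm.sign σ : ℤ) : F) • polytabloid F t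
      rw [← permM_polytabloid]
      apply val_ext
      intro g
      rw [val_permM, val_polytabloid_alt t g hσ, val_smul]
    rw [← val_permM, ← hom_perm hf, h1, map_smul, val_smul]
  have altswap : ∀ (g : Fin n → ℕ) (k l : Fin n), k ≠ l → (t.pos k).2 = (t.pos l).2 →
      val (f (poly F t)) (g ∘ Equiv.swap k l) = - val (f (poly F t)) g := by
    intro g k l hkl hc
    rw [alt, Equiv.Perm.sign_swap hkl]
    · simp
    · rw [mem_colStab]; intro m
      by_cases h1 : m = k
      · subst h1; simp [hc]
      · by_cases h2 : m = l
        · subst h2; simp [hc]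
        · rw [Equiv.swap_apply_of_ne_of_ne h1 h2]
  have hswap : ∀ (A : ℕ × ℕ → ℕ) (p q : ℕ × ℕ), p ∈ α.cells → q ∈ α.cells → p ≠ q → p.2 = q.2 →
      Wof t f (A ∘ Equiv.swap p q) = - Wof t f A := by
    intro A p q hp hq hpq hc
    obtain ⟨k, rfl⟩ := t.surj p hp
    obtain ⟨l, rfl⟩ := t.surj q hq
    unfold Wof
    rw [← altswap _ k l (fun h => hpq (by rw [h])) hc]
    congr 1
    funext m
    simp [swap_comp_pos]
  refine ⟨?_, hswap, ?_, ?_, ?_, ?_⟩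
  · intro A A' h
    unfold Wof
    congr 1
    funext k
    exact h _ (t.mem k)
  · intro A p q hp hq hpq hc hA
    have h1 := hswap A p q hp hq hpq hc
    have h3 : A ∘ Equiv.swap p q = A := by
      funext m
      simp only [Function.comp_apply]
      by_cases ha : m = p
      · subst ha; simp [hA]
      · by_cases hb : m = q
        · subst hb; simp [hA]
        · rw [Equiv.swap_apply_of_ne_of_ne ha hb]
    rw [h3] at h1
    have h4 : (2 : F) * Wof t f A = 0 := by
      rw [two_mul]; nth_rewrite 1 [h1]; simp
    exact (mul_eq_zero.1 h4).resolve_left h2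
  · intro A A' s hs hinj hA h0
    choose σ hσ using fun k => t.surj (s (t.pos k)) (hs _ (t.mem k)).1
    have hσinj : Function.Injective σ := by
      intro k l h
      apply t.inj
      apply hinj (t.mem k) (t.mem l)
      rw [← hσ, ← hσ, h]
    let τ : Equiv.Perm (Fin n) := Equiv.ofBijective σ (Finite.injective_iff_bijective.1 hσinj)
    have hτ : τ ∈ colStab t := by
      rw [mem_colStab]; intro k
      change (t.pos (σ k)).2 = _
      rw [hσ]; exact (hs _ (t.mem k)).2
    have : (fun k => A' (t.pos k)) = (fun k => A (t.pos k)) ∘ τ := by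
      funext k
      change _ = A (t.pos (σ k))
      rw [hσ, hA _ (t.mem k)]
    unfold Wof at h0 ⊢
    rw [this, alt _ _ hτ, h0, mul_zero]
  · intro A z C hz hC0 hC
    obtain ⟨k, rfl⟩ := t.surj z hz
    rw [sum_cells t]
    have h1 : poly F t = ∑ y ∈ Finset.univ.filter (fun y => (t.pos y).2 = C),
        poly F (t.perm (Equiv.swap k y)) := by
      apply Subtype.ext
      rw [Submodule.coe_sum]
      change polytabloid F t = ∑ y ∈ Finset.univ.filter (fun y => (t.pos y).2 = C),
        polytabloid F (t.perm (Equiv.swap k y))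
      apply val_ext
      intro g
      rw [val_sum, val_polytabloid_garnir t g k hC0 hC]
      refine Finset.sum_congr rfl fun y _ => ?_
      rw [← permM_polytabloid, val_permM]
    unfold Wof
    conv_lhs => rw [h1]
    rw [map_sum, val_sum]
    refine Finset.sum_congr rfl fun y _ => ?_
    rw [hom_perm hf, val_permM]
    congr 1
    funext m
    simp [swap_comp_pos]
  · intro A hA j
    rw [card_cells t]
    unfold Wof val at hA
    by_contra hne
    apply hA
    rw [dif_neg]
    intro h
    exact hne (h j)

lemma raiseW_of_hom {β : Partition n} {f : ↥(Specht F α) →ₗ[F] PermMod F n β.parts}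
    (hf : f ∈ SpechtHom F α β.parts (Specht F β)) (t : Placement α) : RaiseW α (Wof t f) := by
  classical
  intro B i j hi hij
  rw [sum_cells t]
  have key : ∀ v ∈ Specht F β, ∀ B : Fin n → ℕ,
      ∑ k ∈ Finset.univ.filter (fun k => B k = i), val v (Function.update B k j) = 0 := by
    intro v hv B
    induction hv using Submodule.span_induction with
    | mem x hx =>
      obtain ⟨T, rfl⟩ := hx
      exact val_polytabloid_raise T B hi hij
    | zero => simp
    | add x y _ _ hx hy => simp only [val_add, Finset.sum_add_distrib, hx, hy, add_zero]
    | smul r x _ hx => simp only [val_smul, ← Finset.mul_sum, hx, mul_zero]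
  rw [← key _ (hf.1 (poly F t)) (fun k => B (t.pos k))]
  refine Finset.sum_congr rfl fun k _ => ?_
  unfold Wof
  congr 1
  funext m
  by_cases h : m = k
  · subst h; simp
  · rw [Function.update_of_ne h, Function.update_of_ne (fun h' => h (t.inj h'))]

lemma hom_eq_zero {tg : Submodule F (PermMod F n c)}
    {f : ↥(Specht F α) →ₗ[F] PermMod F n c}
    (hf : f ∈ SpechtHom F α c tg) (t : Placement α) (h : ∀ A, Wof t f A = 0) : f = 0 := by
  classical
  have h0 : f (poly F t) = 0 := by
    apply val_ext
    intro g
    choose s hs using t.surj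
    have := h (fun p => if hp : p ∈ α.cells then g (s p hp) else 0)
    unfold Wof at this
    rw [val_zero, ← this]
    congr 1
    funext k
    beta_reduce
    rw [dif_pos (t.mem k)]
    congr 1
    apply t.inj
    rw [hs]
  have h1 : ∀ T : Placement α, f (poly F T) = 0 := by
    intro T
    obtain ⟨π, rfl⟩ := exists_perm t T
    rw [hom_perm hf, h0, map_zero]
  apply LinearMap.ext
  rintro ⟨x, hx⟩
  simp only [LinearMap.zero_apply]
  induction hx using Submodule.span_induction with
  | mem x hx =>
    obtain ⟨T, rfl⟩ := hx
    exact h1 T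
  | zero => exact map_zero f
  | add x y hx hy ihx ihy =>
    have := map_add f ⟨x, hx⟩ ⟨y, hy⟩
    rw [ihx, ihy, add_zero] at this
    exact this
  | smul r x hx ih =>
    have := map_smul f r ⟨x, hx⟩
    rw [ih, smul_zero] at this
    exact this

lemma hom_eq_zero_of_isEmpty (h : IsEmpty (Placement α))
    (f : ↥(Specht F α) →ₗ[F] PermMod F n c) : f = 0 := by
  apply LinearMap.ext
  rintro ⟨x, hx⟩
  have : x = 0 := by
    unfold Specht at hx
    rw [Set.range_eq_empty, Submodule.span_empty] at hx
    simpa using hx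
  subst this
  exact map_zero f

end GoodFunctions

section Chains

lemma nextIn_mem {X : Finset ℕ} {b u : ℕ} (hX : ∀ x ∈ X, x < b) (hu : u < b) :
    u < nextIn X b u ∧ nextIn X b u ≤ b ∧ (nextIn X b u ∈ X ∨ nextIn X b u = b) ∧
      ∀ v ∈ X, u < v → nextIn X b u ≤ v := by
  unfold nextIn
  have hne : ({v | v ∈ X ∧ u < v} ∪ {b} : Set ℕ).Nonempty := ⟨b, by simp⟩
  have h1 := Nat.sInf_mem hne
  have h2 : sInf ({v | v ∈ X ∧ u < v} ∪ {b} : Set ℕ) ≤ b := Nat.sInf_le (by simp)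
  have h3 : ∀ v ∈ X, u < v → sInf ({v | v ∈ X ∧ u < v} ∪ {b} : Set ℕ) ≤ v := by
    intro v hv huv
    exact Nat.sInf_le (Or.inl ⟨hv, huv⟩)
  refine ⟨?_, h2, ?_, h3⟩
  · rcases h1 with h1 | h1
    · exact h1.2
    · rw [Set.mem_singleton_iff] at h1; omega
  · rcases h1 with h1 | h1
    · exact Or.inl h1.1
    · exact Or.inr h1

lemma nextIn_eq {X : Finset ℕ} {b u v : ℕ} (huv : u < v) (hv : v ∈ X ∨ v = b) (hvb : v ≤ b)
    (hmin : ∀ w ∈ X, u < w → v ≤ w) : nextIn X b u = v := by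
  unfold nextIn
  apply le_antisymm
  · apply Nat.sInf_le
    rcases hv with hv | hv
    · exact Or.inl ⟨hv, huv⟩
    · exact Or.inr hv
  · apply le_csInf ⟨b, by simp⟩
    rintro w (hw | hw)
    · exact hmin w hw.1 hw.2
    · rw [Set.mem_singleton_iff] at hw; omega

lemma nextIn_insert {X : Finset ℕ} {b l i : ℕ} (hX : ∀ x ∈ X, x < b) (hl : l ∈ X)
    (hli : l < i) (hi : i < nextIn X b l) :
    nextIn (insert i X) b l = i ∧ nextIn (insert i X) b i = nextIn X b l ∧
      (∀ u ∈ X, u ≠ l → nextIn (insert i X) b u = nextIn X b u) ∧ i ∉ X ∧ i < b := by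
  obtain ⟨h1, h2, h3, h4⟩ := nextIn_mem hX (hX l hl)
  have hiX : i ∉ X := fun h => by have := h4 i h hli; omega
  refine ⟨?_, ?_, ?_, hiX, by omega⟩
  · apply nextIn_eq hli (Or.inl (Finset.mem_insert_self _ _)) (by omega)
    intro w hw hlw
    rcases Finset.mem_insert.1 hw with rfl | hw
    · exact le_rfl
    · have := h4 w hw hlw; omega
  · apply nextIn_eq hi _ h2
    · intro w hw hlw
      rcases Finset.mem_insert.1 hw with rfl | hw
      · omega
      · exact h4 w hw (by omega)
    · rcases h3 with h3 | h3
      · exact Or.inl (Finset.mem_insert_of_mem h3)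
      · exact Or.inr h3
  · intro u hu hul
    obtain ⟨g1, g2, g3, g4⟩ := nextIn_mem hX (hX u hu)
    apply nextIn_eq g1 _ g2
    · intro w hw huw
      rcases Finset.mem_insert.1 hw with rfl | hw
      · rcases lt_or_gt_of_ne hul with h | h
        · have := g4 l hl h; omega
        · have := h4 u hu h; omega
      · exact g4 w hw huw
    · rcases g3 with g3 | g3
      · exact Or.inl (Finset.mem_insert_of_mem g3)
      · exact Or.inr g3

/-- The filling attached to a chain `X` and a choice of columns. -/
noncomputable def Nf (X : Finset ℕ) (b : ℕ) (c : ℕ → ℕ) : ℕ × ℕ → ℕ :=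
  fun p => if p.1 ∈ X ∧ p.2 = c p.1 then nextIn X b p.1 else p.1

lemma Nf_pos {X : Finset ℕ} {b : ℕ} {c : ℕ → ℕ} {r s : ℕ} (h : r ∈ X) (h2 : s = c r) :
    Nf X b c (r, s) = nextIn X b r := by
  simp [Nf, h, h2]

lemma Nf_neg {X : Finset ℕ} {b : ℕ} {c : ℕ → ℕ} {r s : ℕ} (h : r ∈ X → s ≠ c r) :
    Nf X b c (r, s) = r := by
  unfold Nf
  rw [if_neg]
  rintro ⟨h1, h2⟩
  exact h h1 h2

lemma Nf_congr {X : Finset ℕ} {b : ℕ} {c c' : ℕ → ℕ} (h : ∀ x ∈ X, c x = c' x) :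
    Nf X b c = Nf X b c' := by
  funext ⟨r, s⟩
  by_cases hr : r ∈ X
  · simp [Nf, hr, h r hr]
  · simp [Nf, hr]

variable {F : Type*} [Field F] {α : Partition n} {ct : ℕ → ℕ} {W : (ℕ × ℕ → ℕ) → F}

lemma mem_cells {r s : ℕ} : (r, s) ∈ α.cells ↔ 0 < r ∧ 0 < s ∧ s ≤ α.parts r := Iff.rfl

lemma raise_raw (hW : GoodW α ct W) (hR : RaiseW α W) {X : Finset ℕ} {b : ℕ} {c : ℕ → ℕ}
    {l i : ℕ} (hX : ∀ x ∈ X, x < b) (hl : l ∈ X) (hli : l < i) (hi : i < nextIn X b l)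
    (hcell : (l, c l) ∈ α.cells) :
    W (Nf X b c) + ∑ s ∈ Finset.Icc 1 (α.parts i),
      W (Nf (insert i X) b (Function.update c i s)) = 0 := by
  classical
  obtain ⟨n1, n2, n3, hiX, hib⟩ := nextIn_insert hX hl hli hi
  set j := nextIn X b l with hj
  have hE := hR (Function.update (Nf X b c) (l, c l) i) i j (by omega) hi
  have hfil : (cellFinset α).filter (fun p => Function.update (Nf X b c) (l, c l) i p = i)
      = insert (l, c l) ((Finset.Icc 1 (α.parts i)).image (fun s => (i, s))) := by
    ext ⟨r, s⟩
    simp only [Finset.mem_filter, mem_cellFinset, Finset.mem_insert, Finset.mem_image,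
      Finset.mem_Icc]
    constructor
    · rintro ⟨h1, h2⟩
      by_cases hrs : (r, s) = (l, c l)
      · exact Or.inl hrs
      · right
        rw [Function.update_of_ne hrs] at h2
        by_cases hr : r ∈ X ∧ s = c r
        · rw [Nf_pos hr.1 hr.2] at h2
          exfalso
          obtain ⟨_, _, g3, _⟩ := nextIn_mem hX (hX r hr.1)
          rw [h2] at g3
          rcases g3 with g3 | g3
          · exact hiX g3
          · omega
        · rw [Nf_neg (fun h h' => hr ⟨h, h'⟩)] at h2
          subst h2
          exact ⟨s, ⟨h1.2.1, h1.2.2⟩, rfl⟩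
    · rintro (h | ⟨s', ⟨h1, h2⟩, h3⟩)
      · rw [h]
        exact ⟨hcell, by simp⟩
      · simp only [Prod.mk.injEq] at h3
        obtain ⟨rfl, rfl⟩ := h3
        refine ⟨⟨by simp only; omega, h1, h2⟩, ?_⟩
        rw [Function.update_of_ne, Nf_neg (fun h => absurd h hiX)]
        simp only [ne_eq, Prod.mk.injEq, not_and]
        intro h; omega
  rw [hfil, Finset.sum_insert, Finset.sum_image] at hE
  · rw [← hE]
    congr 1
    · congr 1
      rw [Function.update_idem, hj]
      symm
      rw [Function.update_eq_self_iff]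
      exact Nf_pos hl rfl |>.symm
    · refine Finset.sum_congr rfl fun s _ => ?_
      congr 1
      funext ⟨r, s'⟩
      by_cases h1 : (r, s') = (i, s)
      · rw [h1, Function.update_self, Nf_pos (Finset.mem_insert_self _ _) (by simp), n2]
      · rw [Function.update_of_ne h1]
        by_cases h2 : (r, s') = (l, c l)
        · rw [h2, Function.update_self, Nf_pos (Finset.mem_insert_of_mem hl), n1]
          rw [Function.update_of_ne (by omega)]
        · rw [Function.update_of_ne h2]
          by_cases h3 : r ∈ X ∧ s' = c r
          · have hrl : r ≠ l := by
              rintro rfl; apply h2; rw [h3.2]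
            have hri : r ≠ i := by
              rintro rfl; exact hiX h3.1
            rw [Nf_pos h3.1 h3.2, Nf_pos (Finset.mem_insert_of_mem h3.1), n3 r h3.1 hrl]
            rw [Function.update_of_ne hri, h3.2]
          · rw [Nf_neg (fun h h' => h3 ⟨h, h'⟩), Nf_neg]
            intro h h'
            by_cases hri : r = i
            · subst hri
              rw [Function.update_self] at h'
              apply h1; rw [h']
            · rw [Function.update_of_ne hri] at h'
              exact h3 ⟨(Finset.mem_insert.1 h).resolve_left hri, h'⟩
  · intro x _ y _ h
    simpa using h
  · simp only [Finset.mem_image, Prod.mk.injEq, not_exists, not_and]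
    intro x _ h; omega

lemma merge (hW : GoodW α ct W) {X : Finset ℕ} {b : ℕ} {c : ℕ → ℕ}
    {l i : ℕ} (hX : ∀ x ∈ X, x < b) (hl : l ∈ X) (hli : l < i) (hi : i < nextIn X b l)
    (hc : c l = c i) (hcell : (l, c l) ∈ α.cells) (hcell' : (i, c i) ∈ α.cells) :
    W (Nf (insert i X) b c) = - W (Nf X b c) := by
  obtain ⟨n1, n2, n3, hiX, hib⟩ := nextIn_insert hX hl hli hi
  rw [← hW.swap (Nf X b c) (l, c l) (i, c i) hcell hcell' (by simp; omega) hc]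
  congr 1
  funext ⟨r, s⟩
  simp only [Function.comp_apply]
  by_cases h1 : (r, s) = (l, c l)
  · rw [h1, Equiv.swap_apply_left, Nf_pos (Finset.mem_insert_of_mem hl) rfl, n1,
      Nf_neg (fun h => absurd h hiX)]
  · by_cases h2 : (r, s) = (i, c i)
    · rw [h2, Equiv.swap_apply_right, Nf_pos (Finset.mem_insert_self _ _) rfl, n2, Nf_pos hl rfl]
    · rw [Equiv.swap_apply_of_ne_of_ne h1 h2]
      by_cases h3 : r ∈ X ∧ s = c r
      · have hrl : r ≠ l := by
          rintro rfl; apply h1; rw [h3.2]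
        rw [Nf_pos h3.1 h3.2, Nf_pos (Finset.mem_insert_of_mem h3.1) h3.2, n3 r h3.1 hrl]
      · rw [Nf_neg (fun h h' => h3 ⟨h, h'⟩), Nf_neg]
        intro h h'
        rcases Finset.mem_insert.1 h with rfl | h
        · apply h2; rw [h']
        · exact h3 ⟨h, h'⟩

lemma garnir_N (hW : GoodW α ct W) {X : Finset ℕ} {b : ℕ} {c : ℕ → ℕ}
    {x C C' : ℕ} (hX : ∀ x ∈ X, x < b) (hx : x ∈ X) (hcx : c x = C) (hC0 : 0 < C) (hCC : C < C')
    (hcell : (x, C') ∈ α.cells) (hdis : ∀ u ∈ X, u ≠ x → c u ≠ C ∧ c u ≠ C')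
    (hgood : α.parts (nextIn X b x) < C) :
    W (Nf X b c) = W (Nf X b (Function.update c x C')) -
      ∑ y ∈ (Finset.Ioo x (nextIn X b x)).filter (fun y => C ≤ α.parts y ∧ α.parts y < C'),
        W (Nf (insert y X) b (Function.update (Function.update c x C') y C)) := by
  classical
  obtain ⟨hx0, hC'0, hxC'⟩ := hcell
  simp only at hx0 hC'0 hxC'
  obtain ⟨g1, g2, g3, g4⟩ := nextIn_mem hX (hX x hx)
  rw [hW.garnir (Nf X b c) (x, C') C ⟨hx0, hC'0, hxC'⟩ hC0 hCC]
  set j := nextIn X b x with hj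
  have hxC : (x, C) ∈ (cellFinset α).filter (fun q => q.2 = C) := by
    simp only [Finset.mem_filter, mem_cellFinset, and_true]
    exact ⟨hx0, hC0, by simp only; omega⟩
  -- entries away from `x`
  have entryC : ∀ y, y ≠ x → Nf X b c (y, C) = y := by
    intro y hy
    exact Nf_neg fun h h' => (hdis y h hy).1 h'.symm
  have entryC' : ∀ y, Nf X b c (y, C') = y := by
    intro y
    apply Nf_neg
    intro h h'
    by_cases hy : y = x
    · subst hy; omega
    · exact (hdis y h hy).2 h'.symm
  rw [← Finset.add_sum_erase _ _ hxC, sub_eq_add_neg]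
  congr 1
  · congr 1
    funext ⟨r, s⟩
    simp only [Function.comp_apply]
    by_cases h1 : (r, s) = (x, C')
    · rw [h1, Equiv.swap_apply_left, Nf_pos hx hcx.symm, Nf_pos hx (by simp)]
    · by_cases h2 : (r, s) = (x, C)
      · rw [h2, Equiv.swap_apply_right, entryC', Nf_neg]
        intro _ h; rw [Function.update_self] at h; omega
      · rw [Equiv.swap_apply_of_ne_of_ne h1 h2]
        by_cases hr : r = x
        · subst hr
          rw [Nf_neg, Nf_neg]
          · intro _ h; rw [Function.update_self] at h; apply h1; rw [h]
          · intro _ h; rw [hcx] at h; apply h2; rw [h]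
        · unfold Nf
          simp only [Function.update_of_ne hr]
  · rw [← Finset.sum_neg_distrib]
    -- kill the vanishing terms
    have hsub : ((Finset.Ioo x j).filter (fun y => C ≤ α.parts y ∧ α.parts y < C')).image
        (fun y => (y, C)) ⊆ ((cellFinset α).filter (fun q => q.2 = C)).erase (x, C) := by
      rintro ⟨y, s⟩ hy
      simp only [Finset.mem_image, Finset.mem_filter, Finset.mem_Ioo, Prod.mk.injEq] at hy
      obtain ⟨y', ⟨⟨h1, h2⟩, h3, h4⟩, rfl, rfl⟩ := hy
      simp only [Finset.mem_erase, ne_eq, Prod.mk.injEq, Finset.mem_filter, mem_cellFinset,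
        and_true]
      exact ⟨by omega, by simp only; omega, hC0, h3⟩
    rw [← Finset.sum_subset hsub]
    · rw [Finset.sum_image (by intro x _ y _ h; simpa using h)]
      refine Finset.sum_congr rfl fun y hy => ?_
      simp only [Finset.mem_filter, Finset.mem_Ioo] at hy
      obtain ⟨⟨h1, h2⟩, h3, h4⟩ := hy
      obtain ⟨n1, n2, n3, hiX, hib⟩ := nextIn_insert hX hx h1 h2
      rw [← hW.swap _ (x, C) (y, C) ⟨hx0, hC0, by simp only; omega⟩
        ⟨by simp only; omega, hC0, h3⟩ (by simp; omega) rfl]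
      congr 1
      funext ⟨r, s⟩
      simp only [Function.comp_apply]
      by_cases e1 : (r, s) = (x, C')
      · rw [e1, Equiv.swap_apply_left, entryC y (by omega),
          Equiv.swap_apply_of_ne_of_ne (by simp; omega) (by simp; omega),
          Nf_pos (Finset.mem_insert_of_mem hx), n1]
        rw [Function.update_of_ne (by omega), Function.update_self]
      · by_cases e2 : (r, s) = (y, C)
        · rw [e2, Equiv.swap_apply_right, Equiv.swap_apply_right, entryC', Nf_neg]
          intro _ h
          rw [Function.update_of_ne (by omega), Function.update_self] at h
          omega
        · rw [Equiv.swap_apply_of_ne_of_ne e1 e2]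
          by_cases e3 : (r, s) = (x, C)
          · rw [e3, Equiv.swap_apply_left, Nf_pos hx hcx.symm,
              Nf_pos (Finset.mem_insert_self _ _) (by simp), n2]
          · rw [Equiv.swap_apply_of_ne_of_ne e3 e2]
            by_cases hr : r ∈ X ∧ s = c r
            · have hrx : r ≠ x := by
                rintro rfl; apply e3; rw [hr.2, hcx]
              have hry : r ≠ y := by
                rintro rfl; exact hiX hr.1
              rw [Nf_pos hr.1 hr.2, Nf_pos (Finset.mem_insert_of_mem hr.1), n3 r hr.1 hrx]
              rw [Function.update_of_ne hry, Function.update_of_ne hrx, hr.2]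
            · rw [Nf_neg (fun h h' => hr ⟨h, h'⟩), Nf_neg]
              intro h h'
              by_cases hry : r = y
              · subst hry
                rw [Function.update_self] at h'
                apply e2; rw [h']
              · rw [Function.update_of_ne hry] at h'
                by_cases hrx : r = x
                · subst hrx
                  rw [Function.update_self] at h'
                  apply e1; rw [h']
                · rw [Function.update_of_ne hrx] at h'
                  exact hr ⟨(Finset.mem_insert.1 h).resolve_left hry, h'⟩
    · rintro ⟨y, s⟩ hy hy'
      simp only [Finset.mem_erase, ne_eq, Prod.mk.injEq, Finset.mem_filter, mem_cellFinset] at hy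
      obtain ⟨h1, h2, rfl⟩ := hy
      have hyx : y ≠ x := fun h => h1 ⟨h, rfl⟩
      obtain ⟨hy0, _, hyC⟩ := h2
      simp only at hy0 hyC
      have hyj : y < j := by
        by_contra h
        have := α.antitone (show 0 < j by omega) (show j ≤ y by omega)
        omega
      have hyC' : C' ≤ α.parts y := by
        by_contra h
        apply hy'
        simp only [Finset.mem_image, Finset.mem_filter, Finset.mem_Ioo, Prod.mk.injEq]
        refine ⟨y, ⟨⟨?_, hyj⟩, hyC, by omega⟩, rfl, trivial⟩
        by_contra h'
        have := α.antitone hy0 (show y ≤ x by omega)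
        omega
      apply hW.rep _ (x, C') (y, C') ⟨hx0, hC'0, hxC'⟩ ⟨hy0, hC'0, hyC'⟩ (by simp; omega) rfl
      simp only [Function.comp_apply]
      rw [Equiv.swap_apply_left, Equiv.swap_apply_of_ne_of_ne (by simp; omega) (by simp; omega),
        entryC y hyx, entryC']

end Chains

section Relations

variable {F : Type*} [Field F] {α : Partition n} {ct : ℕ → ℕ} {W : (ℕ × ℕ → ℕ) → F}

lemma exists_pred {X : Finset ℕ} {a b i : ℕ} (hX : ∀ x ∈ X, x < b) (ha : a ∈ X) (hai : a < i)
    (hib : i < b) (hi : i ∉ X) : ∃ l ∈ X, l < i ∧ i < nextIn X b l := by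
  have hne : (X.filter (· < i)).Nonempty := ⟨a, by simp [ha, hai]⟩
  have hm := Finset.max'_mem _ hne
  have hM := fun x hx => Finset.le_max' (X.filter (· < i)) x hx
  set l := (X.filter (· < i)).max' hne
  simp only [Finset.mem_filter] at hm hM
  refine ⟨l, hm.1, hm.2, ?_⟩
  obtain ⟨g1, g2, g3, g4⟩ := nextIn_mem hX (hX l hm.1)
  by_contra h
  rcases g3 with g3 | g3
  · by_cases h' : nextIn X b l = i
    · exact hi (h' ▸ g3)
    · have := hM _ ⟨g3, by omega⟩
      omega
  · omega

/-- Every row of the chain ends in a removable node. -/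
def Str (α : Partition n) (b : ℕ) (X : Finset ℕ) : Prop :=
  ∀ x ∈ X, x < b ∧ 0 < x ∧ α.parts (x + 1) < α.parts x

/-- The value at the standard filling of a chain. -/
noncomputable def Uw (W : (ℕ × ℕ → ℕ) → F) (α : Partition n) (b : ℕ) (X : Finset ℕ) : F :=
  W (Nf X b α.parts)

/-- The value with one additional row in an arbitrary column. -/
noncomputable def Zw (W : (ℕ × ℕ → ℕ) → F) (α : Partition n) (b : ℕ) (X : Finset ℕ) (i s : ℕ) : F :=
  W (Nf (insert i X) b (Function.update α.parts i s))

lemma Zw_self {b : ℕ} {X : Finset ℕ} {i : ℕ} :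
    Zw W α b X i (α.parts i) = Uw W α b (insert i X) := by
  simp [Zw, Uw]

lemma Str.lt_of_lt {b : ℕ} {X : Finset ℕ} (h : Str α b X) {x y : ℕ} (hx : x ∈ X) (hxy : x < y) :
    α.parts y < α.parts x := by
  have := α.antitone (show 0 < x + 1 by omega) (show x + 1 ≤ y by omega)
  have := (h x hx).2.2
  omega

lemma split_rel (hW : GoodW α ct W) (hR : RaiseW α W) {X : Finset ℕ} {b l i : ℕ}
    (hX : Str α b X) (hl : l ∈ X) (hli : l < i) (hi : i < nextIn X b l) :
    Uw W α b X + (∑ s ∈ Finset.Ioc (α.parts (nextIn X b l)) (α.parts i), Zw W α b X i s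
      + if nextIn X b l < b then Zw W α b X i (α.parts (nextIn X b l)) else 0) = 0 := by
  have hXb : ∀ x ∈ X, x < b := fun x hx => (hX x hx).1
  obtain ⟨g1, g2, g3, g4⟩ := nextIn_mem hXb (hXb l hl)
  obtain ⟨n1, n2, n3, hiX, hib⟩ := nextIn_insert hXb hl hli hi
  have h0 := raise_raw hW hR (c := α.parts) hXb hl hli hi
    ⟨(hX l hl).2.1, by have := (hX l hl).2.2; simp only; omega, le_rfl⟩
  refine Eq.trans ?_ h0
  unfold Uw
  congr 1
  set j := nextIn X b l with hj
  have hji : α.parts j ≤ α.parts i := α.antitone (by omega) hi.le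
  have key : ∀ s, 0 < s → s ≤ α.parts j → (j ∈ X → s ≠ α.parts j) →
      W (Nf (insert i X) b (Function.update α.parts i s)) = 0 := by
    intro s hs hsj hjs
    apply hW.rep _ (i, s) (j, s) ⟨by simp only; omega, hs, by simp only; omega⟩
      ⟨by simp only; omega, hs, hsj⟩ (by simp; omega) rfl
    rw [Nf_pos (Finset.mem_insert_self _ _) (by simp), n2, Nf_neg]
    intro h
    rw [Function.update_of_ne (by omega)]
    exact hjs ((Finset.mem_insert.1 h).resolve_left (by omega))
  by_cases hjb : j < b
  · have hjX : j ∈ X := g3.resolve_right (by omega)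
    have hj1 := (hX j hjX).2.2
    rw [if_pos hjb, add_comm]
    have e : Finset.Icc 1 (α.parts i) = (Finset.Ico 1 (α.parts j)) ∪
        (insert (α.parts j) (Finset.Ioc (α.parts j) (α.parts i))) := by
      ext s; simp only [Finset.mem_Icc, Finset.mem_union, Finset.mem_Ico, Finset.mem_insert,
        Finset.mem_Ioc]; omega
    have z : ∑ s ∈ Finset.Ico 1 (α.parts j),
        W (Nf (insert i X) b (Function.update α.parts i s)) = 0 := by
      apply Finset.sum_eq_zero
      intro s hs
      rw [Finset.mem_Ico] at hs
      exact key s hs.1 hs.2.le (fun _ => by omega)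
    rw [e, Finset.sum_union, Finset.sum_insert (by simp), z, zero_add]
    · rfl
    · rw [Finset.disjoint_left]
      intro s; simp only [Finset.mem_Ico, Finset.mem_insert, Finset.mem_Ioc]; omega
  · rw [if_neg hjb, add_zero]
    have e : Finset.Icc 1 (α.parts i) = (Finset.Icc 1 (α.parts j)) ∪
        (Finset.Ioc (α.parts j) (α.parts i)) := by
      ext s; simp only [Finset.mem_Icc, Finset.mem_union, 
        Finset.mem_Ioc]; omega
    have z : ∑ s ∈ Finset.Icc 1 (α.parts j),
        W (Nf (insert i X) b (Function.update α.parts i s)) = 0 := by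
      apply Finset.sum_eq_zero
      intro s hs
      rw [Finset.mem_Icc] at hs
      exact key s hs.1 hs.2 (fun h => absurd (hXb j h) hjb)
    rw [e, Finset.sum_union, z, zero_add]
    · rfl
    · rw [Finset.disjoint_left]
      intro s; simp only [Finset.mem_Icc, Finset.mem_Ioc]; omega

lemma garnir_rel (hW : GoodW α ct W) {X : Finset ℕ} {b x s : ℕ}
    (hX : Str α b X) (hx : x ∈ X) (hs : α.parts (nextIn X b x) < s) (hs' : s ≤ α.parts x) :
    W (Nf X b (Function.update α.parts x s)) = Uw W α b X -
      ∑ y ∈ (Finset.Ioo x (nextIn X b x)).filter (fun y => s ≤ α.parts y), Zw W α b X y s := by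
  have hXb : ∀ x ∈ X, x < b := fun x hx => (hX x hx).1
  obtain ⟨g1, g2, g3, g4⟩ := nextIn_mem hXb (hXb x hx)
  rcases hs'.eq_or_lt with rfl | hlt
  · rw [Function.update_eq_self, Finset.filter_false_of_mem]
    · simp [Uw]
    · intro y hy
      rw [Finset.mem_Ioo] at hy
      have := hX.lt_of_lt hx hy.1
      omega
  · rw [garnir_N hW hXb hx (C := s) (C' := α.parts x) (by simp) (by omega) hlt
      ⟨(hX x hx).2.1, by simp only; omega, le_rfl⟩ _ hs]
    · simp only [Function.update_idem, Function.update_eq_self]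
      congr 1
      refine Finset.sum_congr ?_ fun _ _ => rfl
      ext y
      simp only [Finset.mem_filter, Finset.mem_Ioo]
      constructor
      · rintro ⟨h1, h2, h3⟩; exact ⟨h1, h2⟩
      · rintro ⟨h1, h2⟩; exact ⟨h1, h2, hX.lt_of_lt hx h1.1⟩
    · intro u hu hux
      rw [Function.update_of_ne hux]
      rcases lt_or_gt_of_ne hux with h | h
      · have := hX.lt_of_lt hu h; omega
      · have h3 := g4 u hu h
        have := α.antitone (by omega) h3
        omega

lemma Str.insert {b : ℕ} {X : Finset ℕ} (h : Str α b X) {i : ℕ} (h1 : i < b) (h2 : 0 < i)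
    (h3 : α.parts (i + 1) < α.parts i) : Str α b (insert i X) := by
  intro x hx
  rcases Finset.mem_insert.1 hx with rfl | hx
  · exact ⟨h1, h2, h3⟩
  · exact h x hx

lemma Str.erase {b : ℕ} {X : Finset ℕ} (h : Str α b X) {i : ℕ} : Str α b (X.erase i) :=
  fun x hx => h x (Finset.mem_of_mem_erase hx)

lemma rel_one (hW : GoodW α ct W) (hR : RaiseW α W) {X : Finset ℕ} {b l i : ℕ}
    (hX : Str α b X) (hl : l ∈ X) (hli : l < i) (hi : i < nextIn X b l)
    (hri : α.parts (i + 1) < α.parts i) :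
    Uw W α b X + ((hook α b i : F) - (hook α b (nextIn X b l) : F)) * Uw W α b (insert i X)
      - (if nextIn X b l < b then Uw W α b ((insert i X).erase (nextIn X b l)) else 0) = 0 := by
  have hXb : ∀ x ∈ X, x < b := fun x hx => (hX x hx).1
  obtain ⟨g1, g2, g3, g4⟩ := nextIn_mem hXb (hXb l hl)
  obtain ⟨n1, n2, n3, hiX, hib⟩ := nextIn_insert hXb hl hli hi
  have hX' : Str α b (insert i X) := hX.insert hib (by omega) hri
  have hX'b : ∀ x ∈ insert i X, x < b := fun x hx => (hX' x hx).1
  have s1 := split_rel hW hR hX hl hli hi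
  set j := nextIn X b l with hj
  have hji : α.parts j ≤ α.parts i := α.antitone (by omega) hi.le
  set X' := insert i X with hX'def
  have hiX' : i ∈ X' := Finset.mem_insert_self _ _
  have s2 : ∑ s ∈ Finset.Ioc (α.parts j) (α.parts i), Zw W α b X i s =
      ((α.parts i : F) - α.parts j) * Uw W α b X' -
        ∑ y ∈ Finset.Ioo i j, ∑ s ∈ Finset.Ioc (α.parts j) (α.parts y), Zw W α b X' y s := by
    have : ∀ s ∈ Finset.Ioc (α.parts j) (α.parts i), Zw W α b X i s = Uw W α b X' -
        ∑ y ∈ Finset.Ioo i j, if s ≤ α.parts y then Zw W α b X' y s else 0 := by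
      intro s hs
      rw [Finset.mem_Ioc] at hs
      have := garnir_rel hW hX' hiX' (s := s) (by rw [n2]; exact hs.1) hs.2
      rw [n2] at this
      rw [← Finset.sum_filter]
      exact this
    rw [Finset.sum_congr rfl this, Finset.sum_sub_distrib, Finset.sum_const, Nat.card_Ioc,
      nsmul_eq_mul, Nat.cast_sub hji, Finset.sum_comm]
    congr 1
    refine Finset.sum_congr rfl fun y hy => ?_
    rw [Finset.mem_Ioo] at hy
    have := hX'.lt_of_lt hiX' hy.1
    rw [← Finset.sum_filter]
    refine Finset.sum_congr ?_ fun _ _ => rfl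
    ext s
    simp only [Finset.mem_filter, Finset.mem_Ioc]
    omega
  have s3 : ∀ y ∈ Finset.Ioo i j, ∑ s ∈ Finset.Ioc (α.parts j) (α.parts y), Zw W α b X' y s =
      - Uw W α b X' - if j < b then Zw W α b X' y (α.parts j) else 0 := by
    intro y hy
    rw [Finset.mem_Ioo] at hy
    have := split_rel hW hR hX' hiX' hy.1 (by rw [n2]; exact hy.2)
    rw [n2] at this
    linear_combination this
  rw [s2, Finset.sum_congr rfl s3, Finset.sum_sub_distrib, Finset.sum_const, Nat.card_Ioo,
    nsmul_eq_mul, Nat.cast_sub (by omega), Nat.cast_sub (by omega)] at s1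
  by_cases hjb : j < b
  · have hjX : j ∈ X := g3.resolve_right (by omega)
    have hjX' : j ∈ X' := Finset.mem_insert_of_mem hjX
    have hj1 := (hX j hjX).2.2
    simp only [if_pos hjb] at s1 ⊢
    set Y := X'.erase j with hY
    have hYX : insert j Y = X' := Finset.insert_erase hjX'
    have hYs : Str α b Y := hX'.erase
    have hYb : ∀ x ∈ Y, x < b := fun x hx => (hYs x hx).1
    have hiY : i ∈ Y := Finset.mem_erase.2 ⟨by omega, hiX'⟩
    have hjj : j < nextIn Y b i := by
      obtain ⟨k1, k2, k3, k4⟩ := nextIn_mem hYb (hYb i hiY)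
      by_contra h
      rcases k3 with k3 | k3
      · have h5 := Finset.mem_erase.1 k3
        have h6 := (nextIn_mem hX'b (hX'b i hiX')).2.2.2 _ h5.2 k1
        rw [n2] at h6
        omega
      · omega
    have hlt : α.parts (nextIn Y b i) < α.parts j := hX.lt_of_lt hjX hjj
    have e1 : Zw W α b X i (α.parts j) = - W (Nf Y b (Function.update α.parts i (α.parts j))) := by
      have := merge hW (c := Function.update α.parts i (α.parts j)) hYb hiY hi hjj
        (by rw [Function.update_self, Function.update_of_ne (by omega)])
        ⟨by simp only; omega, by simp only [Function.update_self]; omega,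
          by simp only [Function.update_self]; omega⟩
        ⟨by simp only; omega, by simp only; rw [Function.update_of_ne (by omega)]; omega,
          by simp only; rw [Function.update_of_ne (by omega)]⟩
      rw [← this, hYX]; rfl
    rw [garnir_rel hW hYs hiY hlt hji] at e1
    have e2 : (Finset.Ioo i (nextIn Y b i)).filter (fun y => α.parts j ≤ α.parts y)
        = insert j (Finset.Ioo i j) := by
      ext y
      simp only [Finset.mem_filter, Finset.mem_Ioo, Finset.mem_insert]
      constructor
      · rintro ⟨⟨h1, h2⟩, h3⟩
        have : y ≤ j := by
          by_contra h
          have := hX.lt_of_lt hjX (show j < y by omega)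
          omega
        omega
      · rintro (rfl | ⟨h1, h2⟩)
        · exact ⟨⟨hi, hjj⟩, le_rfl⟩
        · exact ⟨⟨h1, by omega⟩, α.antitone (by omega) h2.le⟩
    rw [e2, Finset.sum_insert (by simp), Zw_self, hYX] at e1
    have e3 : ∀ y ∈ Finset.Ioo i j, Zw W α b X' y (α.parts j) = - Zw W α b Y y (α.parts j) := by
      intro y hy
      rw [Finset.mem_Ioo] at hy
      obtain ⟨m1, m2, m3, hyY, hyb⟩ := nextIn_insert hYb hiY hy.1 (by omega)
      have hYy : ∀ x ∈ insert y Y, x < b := by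
        intro x hx
        rcases Finset.mem_insert.1 hx with rfl | hx
        · exact hyb
        · exact hYb x hx
      have := merge hW (c := Function.update α.parts y (α.parts j)) hYy
        (Finset.mem_insert_self y Y) hy.2 (by rw [m2]; exact hjj)
        (by rw [Function.update_self, Function.update_of_ne (by omega)])
        ⟨by simp only; omega, by simp only [Function.update_self]; omega,
          by simp only [Function.update_self]; exact α.antitone (by omega) hy.2.le⟩
        ⟨by simp only; omega, by simp only; rw [Function.update_of_ne (by omega)]; omega,
          by simp only; rw [Function.update_of_ne (by omega)]⟩
      unfold Zw
      rw [← this, Finset.insert_comm j y Y, hYX]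
    rw [Finset.sum_congr rfl e3, Finset.sum_neg_distrib] at s1
    rw [e1] at s1
    unfold hook
    rw [if_pos hib, if_pos hjb]
    push_cast at s1 ⊢
    linear_combination s1
  · have : j = b := by omega
    simp only [if_neg hjb] at s1 ⊢
    unfold hook
    rw [if_pos hib, if_neg hjb]
    rw [this] at s1
    push_cast at s1 ⊢
    simp only [Finset.sum_const_zero] at s1
    linear_combination s1

lemma mem_Rset {a b i : ℕ} : i ∈ Rset α a b ↔ a ≤ i ∧ i ≤ b - 1 ∧ α.parts (i + 1) < α.parts i := by
  simp [Rset, and_assoc]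

lemma rel_two (hW : GoodW α ct W) (hR : RaiseW α W) {a b : ℕ} (ha : 0 < a) (hab : a < b) :
    ∀ k i, b - i = k → ∀ X ⊆ Rset α a b, a ∈ X → i ∈ Rset α a b → i ∉ X →
      Uw W α b X = - (hook α b i : F) * Uw W α b (insert i X) := by
  intro k
  induction k using Nat.strong_induction_on with
  | _ k ih =>
  intro i hk X hXR haX hiR hiX
  have hX : Str α b X := by
    intro x hx
    have := mem_Rset.1 (hXR hx)
    exact ⟨by omega, by omega, this.2.2⟩
  have hXb : ∀ x ∈ X, x < b := fun x hx => (hX x hx).1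
  have hi := mem_Rset.1 hiR
  have hai : a < i := lt_of_le_of_ne hi.1 (fun h => hiX (h ▸ haX))
  obtain ⟨l, hl, hli, hin⟩ := exists_pred hXb haX hai (by omega) hiX
  obtain ⟨g1, g2, g3, g4⟩ := nextIn_mem hXb (hXb l hl)
  have h1 := rel_one hW hR hX hl hli hin hi.2.2
  set j := nextIn X b l
  by_cases hjb : j < b
  · have hjX : j ∈ X := g3.resolve_right (by omega)
    rw [if_pos hjb] at h1
    have h2 := ih (b - j) (by omega) j rfl ((insert i X).erase j) (by
      intro x hx
      rcases Finset.mem_insert.1 (Finset.mem_of_mem_erase hx) with rfl | hx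
      · exact hiR
      · exact hXR hx) (by
        rw [Finset.mem_erase]
        exact ⟨by omega, Finset.mem_insert_of_mem haX⟩) (hXR hjX) (by simp)
    rw [Finset.insert_erase (Finset.mem_insert_of_mem hjX)] at h2
    rw [h2] at h1
    linear_combination h1
  · rw [if_neg hjb] at h1
    have : hook α b j = 0 := by unfold hook; rw [if_neg hjb]
    rw [this] at h1
    push_cast at h1
    linear_combination h1

lemma rel_two' (hW : GoodW α ct W) (hR : RaiseW α W) {a b : ℕ} (ha : 0 < a) (hab : a < b) :
    ∀ (k : ℕ) (X : Finset ℕ), X ⊆ Rset α a b → a ∈ X → (Rset α a b \ X).card = k →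
      Uw W α b X = (-1) ^ k * (∏ r ∈ Rset α a b \ X, (hook α b r : F)) *
        Uw W α b (Rset α a b) := by
  intro k
  induction k with
  | zero =>
    intro X hX haX hk
    rw [Finset.card_eq_zero, Finset.sdiff_eq_empty_iff_subset] at hk
    have : X = Rset α a b := Finset.Subset.antisymm hX hk
    subst this
    simp
  | succ k ih =>
    intro X hX haX hk
    obtain ⟨i, hi⟩ := Finset.card_pos.1 (show 0 < (Rset α a b \ X).card by omega)
    have hi' := Finset.mem_sdiff.1 hi
    have e : Rset α a b \ insert i X = (Rset α a b \ X).erase i := by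
      ext x; simp only [Finset.mem_sdiff, Finset.mem_insert, Finset.mem_erase]; tauto
    rw [rel_two hW hR ha hab _ i rfl X hX haX hi'.1 hi'.2,
      ih (insert i X) (Finset.insert_subset hi'.1 hX) (Finset.mem_insert_of_mem haX)
        (by rw [e, Finset.card_erase_of_mem hi]; omega), e, ← Finset.mul_prod_erase _ _ hi]
    ring

lemma rel_three (hW : GoodW α ct W) (hR : RaiseW α W) {β : Partition n} {a b : ℕ}
    (hs : OneBoxShift α β a b) :
    ∀ (k : ℕ) (X : Finset ℕ), IsSSSet α a b X → (X \ Rset α a b).card = k →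
      Uw W α b X = (-1) ^ k * Uw W α b (X ∩ Rset α a b) := by
  have ha := hs.a_pos
  have hab := hs.a_lt_b
  have haR : a ∈ Rset α a b := mem_Rset.2 ⟨le_rfl, by omega, hs.rem⟩
  intro k
  induction k with
  | zero =>
    intro X hX hk
    rw [Finset.card_eq_zero, Finset.sdiff_eq_empty_iff_subset] at hk
    rw [Finset.inter_eq_left.2 hk]
    simp
  | succ k ih =>
    intro X hX hk
    have hne : (X \ Rset α a b).Nonempty := Finset.card_pos.1 (by omega)
    have hu := Finset.min'_mem _ hne
    have hmin := fun x hx => Finset.min'_le (X \ Rset α a b) x hx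
    set u := (X \ Rset α a b).min' hne
    have hu' := Finset.mem_sdiff.1 hu
    obtain ⟨hX1, hX2, hX3⟩ := hX
    have hu2 := hX2 u hu'.1
    have hau : a < u := lt_of_le_of_ne hu2.1 (fun h => hu'.2 (h ▸ haR))
    have heq : ∀ v ∈ X, v ∉ Rset α a b → α.parts (v + 1) = α.parts v := by
      intro v hv hvR
      have h1 := hX2 v hv
      have h2 := α.antitone (show 0 < v by omega) (show v ≤ v + 1 by omega)
      by_contra h
      exact hvR (mem_Rset.2 ⟨h1.1, h1.2, by omega⟩)
    have hu3 := heq u hu'.1 hu'.2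
    have hu4 := hX3 u hu'.1 hu3
    have hu5 := hX2 _ hu4
    have hpos : 0 < α.parts u := by
      have h1 := hs.add
      have h2 := α.antitone (show 0 < u by omega) (show u ≤ b - 1 by omega)
      omega
    set Y := X.erase u with hY
    have hYX : insert u Y = X := Finset.insert_erase hu'.1
    have huY : u ∉ Y := by simp [hY]
    have haY : a ∈ Y := Finset.mem_erase.2 ⟨by omega, hX1⟩
    have hu1Y : u + 1 ∈ Y := Finset.mem_erase.2 ⟨by omega, hu4⟩
    have hYs : IsSSSet α a b Y := by
      refine ⟨haY, fun v hv => hX2 v (Finset.mem_of_mem_erase hv), fun v hv hv2 => ?_⟩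
      have hv' := Finset.mem_erase.1 hv
      refine Finset.mem_erase.2 ⟨?_, hX3 v hv'.2 hv2⟩
      intro h
      have := hmin v (Finset.mem_sdiff.2 ⟨hv'.2, fun h' => by have := mem_Rset.1 h'; omega⟩)
      omega
    have hYb : ∀ x ∈ Y, x < b := fun x hx => by have := hYs.2.1 x hx; omega
    obtain ⟨l, hl, hlu, hun⟩ := exists_pred hYb haY hau (by omega) huY
    obtain ⟨n1, n2, n3, _, hib⟩ := nextIn_insert hYb hl hlu hun
    have hnext : nextIn Y b l = u + 1 :=
      le_antisymm ((nextIn_mem hYb (hYb l hl)).2.2.2 _ hu1Y (by omega)) (by omega)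
    have hl2 := hYs.2.1 l hl
    have h0 := raise_raw hW hR (c := α.parts) hYb hl hlu hun
      ⟨by simp only; omega, by
        have h2 := α.antitone (show 0 < l by omega) (show l ≤ u by omega)
        simp only; omega, le_rfl⟩
    rw [Finset.sum_eq_single (α.parts u)] at h0
    · rw [Function.update_eq_self, hYX] at h0
      have e1 := ih Y hYs (by
        have : Y \ Rset α a b = (X \ Rset α a b).erase u := by
          ext x; simp only [hY, Finset.mem_sdiff, Finset.mem_erase]; tauto
        rw [this, Finset.card_erase_of_mem hu]; omega)
      have e2 : Y ∩ Rset α a b = X ∩ Rset α a b := by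
        ext x; simp only [hY, Finset.mem_inter, Finset.mem_erase]
        constructor
        · tauto
        · rintro ⟨h1, h2⟩
          exact ⟨⟨fun h => hu'.2 (h ▸ h2), h1⟩, h2⟩
      rw [e2] at e1
      unfold Uw at e1 ⊢
      rw [pow_succ]
      linear_combination h0 - e1
    · intro s hs1 hs2
      rw [Finset.mem_Icc] at hs1
      apply hW.rep _ (u, s) (u + 1, s) ⟨by simp only; omega, by simp only; omega, hs1.2⟩
        ⟨by simp only; omega, by simp only; omega, by simp only; omega⟩ (by simp) rfl
      rw [Nf_pos (Finset.mem_insert_self _ _) (by simp), n2, hnext, Nf_neg]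
      intro _
      rw [Function.update_of_ne (by omega)]
      omega
    · intro h
      exact absurd (Finset.mem_Icc.2 ⟨hpos, le_rfl⟩) h

lemma rel_final (hW : GoodW α ct W) (hR : RaiseW α W) {β : Partition n} {a b : ℕ}
    (hs : OneBoxShift α β a b) : ∃ c : F, ∀ X, IsSSSet α a b X →
      Uw W α b X = c * ((-1) ^ X.card * ∏ r ∈ Rset α a b \ X, (hook α b r : F)) := by
  have hab := hs.a_lt_b
  have haR : a ∈ Rset α a b := mem_Rset.2 ⟨le_rfl, by omega, hs.rem⟩
  refine ⟨(-1) ^ (Rset α a b).card * Uw W α b (Rset α a b), fun X hX => ?_⟩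
  have e : Rset α a b \ (X ∩ Rset α a b) = Rset α a b \ X := by
    ext x; simp only [Finset.mem_sdiff, Finset.mem_inter]; tauto
  rw [rel_three hW hR hs _ X hX rfl, rel_two' hW hR hs.a_pos hab _ (X ∩ Rset α a b)
    Finset.inter_subset_right (Finset.mem_inter.2 ⟨hX.1, haR⟩) rfl, e]
  have h1 := Finset.card_sdiff_add_card_inter X (Rset α a b)
  have h2 := Finset.card_sdiff_add_card_inter (Rset α a b) X
  rw [Finset.inter_comm] at h2
  have h3 : (-1 : F) ^ (X \ Rset α a b).card * (-1) ^ (Rset α a b \ X).card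
      = (-1) ^ X.card * (-1) ^ (Rset α a b).card := by
    rw [← h1, ← h2, pow_add, pow_add]
    have : (-1 : F) ^ (X ∩ Rset α a b).card * (-1) ^ (X ∩ Rset α a b).card = 1 := by
      rw [← mul_pow]; simp
    linear_combination -((-1 : F) ^ (X \ Rset α a b).card * (-1) ^ (Rset α a b \ X).card) * this
  linear_combination (∏ r ∈ Rset α a b \ X, (hook α b r : F)) * Uw W α b (Rset α a b) * h3

end Relations

section Vanishing

variable {F : Type*} [Field F] {α : Partition n} {ct : ℕ → ℕ} {W : (ℕ × ℕ → ℕ) → F}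

lemma U_zero (hW : GoodW α ct W) {β : Partition n} {a b : ℕ} (hs : OneBoxShift α β a b)
    (h0 : ∀ X, IsSSSet α a b X → Uw W α b X = 0) :
    ∀ (k : ℕ) (X : Finset ℕ), b - X.card = k → a ∈ X → (∀ x ∈ X, a ≤ x ∧ x < b) →
      Uw W α b X = 0 := by
  intro k
  induction k using Nat.strong_induction_on with
  | _ k ih =>
  intro X hk haX hX
  have ha := hs.a_pos
  have hab := hs.a_lt_b
  by_cases hss : ∀ u ∈ X, α.parts (u + 1) = α.parts u → u + 1 ∈ X
  · exact h0 X ⟨haX, fun u hu => by have := hX u hu; omega, hss⟩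
  · push Not at hss
    obtain ⟨u, hu, hu1, hu2⟩ := hss
    have hub := hX u hu
    have hu1b : u + 1 < b := by
      by_contra h
      have e : u = b - 1 := by omega
      have := hs.add
      rw [show b = u + 1 by omega] at this
      simp only [Nat.add_sub_cancel] at this
      omega
    have hpos : 0 < α.parts u := by
      have h1 := hs.add
      have h2 := α.antitone (show 0 < u by omega) (show u ≤ b - 1 by omega)
      omega
    have hXb : ∀ x ∈ X, x < b := fun x hx => (hX x hx).2
    have hnx : u + 1 < nextIn X b u := by
      obtain ⟨g1, g2, g3, g4⟩ := nextIn_mem hXb hub.2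
      rcases g3 with g3 | g3
      · by_contra h
        apply hu2
        rwa [show u + 1 = nextIn X b u by omega]
      · omega
    have hm := merge hW (c := α.parts) hXb hu (Nat.lt_succ_self u) hnx hu1.symm
      ⟨by simp only; omega, hpos, le_rfl⟩ ⟨by simp only; omega, by simp only [Nat.succ_eq_add_one]; omega, le_rfl⟩
    have hcard : (insert (u + 1) X).card = X.card + 1 := Finset.card_insert_of_notMem hu2
    have hle : X.card ≤ b - a := by
      rw [← Nat.card_Ico]
      apply Finset.card_le_card
      intro x hx
      exact Finset.mem_Ico.2 (hX x hx)
    have hz := ih (b - (insert (u + 1) X).card) (by omega) _ rfl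
      (Finset.mem_insert_of_mem haX) (by
        intro x hx
        rcases Finset.mem_insert.1 hx with rfl | hx
        · omega
        · exact hX x hx)
    unfold Uw at hz ⊢
    rw [Nat.succ_eq_add_one] at hm
    rw [hm] at hz
    simpa using hz

/-- Good chain data. -/
def GoodC (α : Partition n) (a b : ℕ) (X : Finset ℕ) (c : ℕ → ℕ) : Prop :=
  a ∈ X ∧ (∀ x ∈ X, a ≤ x ∧ x < b) ∧ ∀ x ∈ X, c x ≤ α.parts x ∧ α.parts (nextIn X b x) < c x

lemma good_zero (hW : GoodW α ct W) {β : Partition n} {a b : ℕ} (hs : OneBoxShift α β a b)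
    (h0 : ∀ X, IsSSSet α a b X → Uw W α b X = 0) :
    ∀ (k m : ℕ), b - m = k → ∀ (X : Finset ℕ) (c : ℕ → ℕ), GoodC α a b X c →
      (∀ x ∈ X, x < m → c x = α.parts x) → W (Nf X b c) = 0 := by
  have ha := hs.a_pos
  intro k
  induction k with
  | zero =>
    intro m hm X c hG hc
    rw [Nf_congr (c' := α.parts) (fun x hx => hc x hx (by have := (hG.2.1 x hx).2; omega))]
    exact U_zero hW hs h0 _ X rfl hG.1 hG.2.1
  | succ k ih =>
    intro m hm X c hG hc
    obtain ⟨haX, hX, hg⟩ := hG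
    have hXb : ∀ x ∈ X, x < b := fun x hx => (hX x hx).2
    by_cases hmX : m ∈ X
    · by_cases hcm : c m = α.parts m
      · apply ih (m + 1) (by omega) X c ⟨haX, hX, hg⟩
        intro x hx hxm
        by_cases h : x = m
        · rw [h, hcm]
        · exact hc x hx (by omega)
      · obtain ⟨g1, g2, g3, g4⟩ := nextIn_mem hXb (hXb m hmX)
        have hgm := hg m hmX
        have hma := hX m hmX
        rw [garnir_N hW hXb hmX (C := c m) (C' := α.parts m) rfl (by omega) (by omega)
          ⟨by simp only; omega, by simp only; omega, le_rfl⟩ _ hgm.2]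
        · rw [ih (m + 1) (by omega) X _ ⟨haX, hX, _⟩ _, Finset.sum_eq_zero, sub_zero]
          · intro y hy
            simp only [Finset.mem_filter, Finset.mem_Ioo] at hy
            obtain ⟨⟨h1, h2⟩, h3, h4⟩ := hy
            obtain ⟨n1, n2, n3, hyX, hyb⟩ := nextIn_insert hXb hmX h1 h2
            apply ih (m + 1) (by omega) (insert y X) _ ⟨Finset.mem_insert_of_mem haX, _, _⟩
            · intro x hx hxm
              have hxX := (Finset.mem_insert.1 hx).resolve_left (by omega)
              rw [Function.update_of_ne (by omega)]
              by_cases h : x = m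
              · rw [h, Function.update_self]
              · rw [Function.update_of_ne h]
                exact hc x hxX (by omega)
            · intro x hx
              rcases Finset.mem_insert.1 hx with rfl | hx
              · omega
              · exact hX x hx
            · intro x hx
              rcases Finset.mem_insert.1 hx with rfl | hx
              · rw [Function.update_self, n2]
                omega
              · have hxy : x ≠ y := fun h => hyX (h ▸ hx)
                rw [Function.update_of_ne hxy]
                by_cases h : x = m
                · rw [h, Function.update_self, n1]
                  omega
                · rw [Function.update_of_ne h, n3 x hx h]
                  exact hg x hx
          · intro x hx
            by_cases h : x = m
            · rw [h, Function.update_self]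
              omega
            · rw [Function.update_of_ne h]
              exact hg x hx
          · intro x hx hxm
            by_cases h : x = m
            · rw [h, Function.update_self]
            · rw [Function.update_of_ne h]
              exact hc x hx (by omega)
        · intro u hu hum
          have hgu := hg u hu
          rcases lt_or_gt_of_ne hum with h | h
          · obtain ⟨k1, k2, k3, k4⟩ := nextIn_mem hXb (hXb u hu)
            have := α.antitone (by omega) (k4 m hmX h)
            omega
          · have := α.antitone (by omega) (g4 u hu h)
            omega
    · apply ih (m + 1) (by omega) X c ⟨haX, hX, hg⟩
      intro x hx hxm
      exact hc x hx (by have : x ≠ m := fun h => hmX (h ▸ hx); omega)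

/-- The value `v` occurs in column `C` of the filling `A`. -/
def InCol (α : Partition n) (A : ℕ × ℕ → ℕ) (C v : ℕ) : Prop :=
  ∃ r, (r, C) ∈ α.cells ∧ A (r, C) = v

open Classical in
/-- The deficiency of column `C` at height `i`. -/
noncomputable def Dfc (α : Partition n) (A : ℕ × ℕ → ℕ) (C i : ℕ) : ℤ :=
  ∑ v ∈ Finset.Icc 1 i, ((if (v, C) ∈ α.cells then 1 else 0) - (if InCol α A C v then 1 else 0))

open Classical in
lemma Dfc_succ (A : ℕ × ℕ → ℕ) (C i : ℕ) : Dfc α A C (i + 1) = Dfc α A C i +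
    ((if (i + 1, C) ∈ α.cells then 1 else 0) - (if InCol α A C (i + 1) then 1 else 0)) := by
  unfold Dfc
  rw [Finset.sum_Icc_succ_top (by omega)]

lemma Dfc_nonneg (A : ℕ × ℕ → ℕ) (C i : ℕ) : 0 ≤ Dfc α A C i := by
  classical
  have h : ((Finset.Icc 1 i).filter (fun v => InCol α A C v)).card ≤
      ((Finset.Icc 1 i).filter (fun v => (v, C) ∈ α.cells)).card := by
    by_cases h : ∀ v ∈ Finset.Icc 1 i, (v, C) ∈ α.cells
    · rw [Finset.filter_true_of_mem h]
      exact Finset.card_filter_le _ _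
    · push Not at h
      obtain ⟨v, hv, hvC⟩ := h
      rw [Finset.mem_Icc] at hv
      refine le_trans (Finset.card_le_card ?_)
        (Finset.card_image_le (f := fun r => A (r, C)))
      intro w hw
      simp only [Finset.mem_filter] at hw
      obtain ⟨hw1, r, hr, hrw⟩ := hw
      simp only [Finset.mem_image, Finset.mem_filter, Finset.mem_Icc]
      refine ⟨r, ⟨⟨hr.1, ?_⟩, hr⟩, hrw⟩
      by_contra hlt
      apply hvC
      have h1 := α.antitone (show 0 < v by omega) (show v ≤ r by omega)
      have h2 := hr.2.2
      exact ⟨by simp only; omega, hr.2.1, by simp only at h2 ⊢; omega⟩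
  unfold Dfc
  rw [Finset.sum_sub_distrib, Finset.sum_boole, Finset.sum_boole]
  have : (((Finset.Icc 1 i).filter (fun v => InCol α A C v)).card : ℤ) ≤
      ((Finset.Icc 1 i).filter (fun v => (v, C) ∈ α.cells)).card := by exact_mod_cast h
  simpa using this

lemma Dfc_sum {β : Partition n} {a b : ℕ} (hs : OneBoxShift α β a b) {A : ℕ × ℕ → ℕ}
    (hinj : ∀ p ∈ α.cells, ∀ q ∈ α.cells, p.2 = q.2 → A p = A q → p = q)
    (hty : IsTypeOf α β.parts A) (i : ℕ) :
    ∑ C ∈ Finset.Icc 1 (α.parts 1), Dfc α A C i = if a ≤ i ∧ i < b then 1 else 0 := by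
  classical
  have ha := hs.a_pos
  have hab := hs.a_lt_b
  have e1 : ∑ C ∈ Finset.Icc 1 (α.parts 1), Dfc α A C i
      = ∑ v ∈ Finset.Icc 1 i, ((α.parts v : ℤ) - β.parts v) := by
    unfold Dfc
    rw [Finset.sum_comm]
    refine Finset.sum_congr rfl fun v hv => ?_
    rw [Finset.mem_Icc] at hv
    rw [Finset.sum_sub_distrib, Finset.sum_boole, Finset.sum_boole]
    congr 2
    · have : (Finset.Icc 1 (α.parts 1)).filter (fun C => (v, C) ∈ α.cells)
          = Finset.Icc 1 (α.parts v) := by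
        ext C
        have := α.antitone (show 0 < 1 by omega) hv.1
        simp only [Finset.mem_filter, Finset.mem_Icc, mem_cells]
        omega
      rw [this]; simp
    · rw [← hty v]
      symm
      apply Finset.card_bij (fun p _ => p.2)
      · rintro ⟨r, C⟩ hp
        simp only [Finset.mem_filter, mem_cellFinset] at hp
        simp only [Finset.mem_filter, Finset.mem_Icc]
        have h1 := α.antitone (show 0 < 1 by omega) (show 1 ≤ r from hp.1.1)
        have h2 := hp.1.2.2
        have h3 := hp.1.2.1
        simp only at h2 h3
        exact ⟨⟨h3, by omega⟩, r, hp.1, hp.2⟩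
      · intro p hp q hq hpq
        simp only [Finset.mem_filter, mem_cellFinset] at hp hq
        exact hinj p hp.1 q hq.1 hpq (hp.2.trans hq.2.symm)
      · intro C hC
        simp only [Finset.mem_filter, Finset.mem_Icc] at hC
        obtain ⟨_, r, hr, hrv⟩ := hC
        exact ⟨(r, C), by simp [mem_cellFinset, hr, hrv], rfl⟩
  rw [e1]
  clear e1
  induction i with
  | zero => simp; omega
  | succ i ih =>
    rw [Finset.sum_Icc_succ_top (by omega), ih]
    have h1 := hs.at_a
    have h2 := hs.at_b
    have h3 := hs.elsewhere (i + 1)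
    have h4 := hs.rem
    by_cases ha' : i + 1 = a
    · rw [ha', h1]
      split_ifs <;> omega
    · by_cases hb' : i + 1 = b
      · rw [hb', h2]
        split_ifs <;> omega
      · rw [h3 ha' hb']
        split_ifs <;> omega

lemma exists_d {β : Partition n} {a b : ℕ} (hs : OneBoxShift α β a b) {A : ℕ × ℕ → ℕ}
    (hinj : ∀ p ∈ α.cells, ∀ q ∈ α.cells, p.2 = q.2 → A p = A q → p = q)
    (hty : IsTypeOf α β.parts A) : ∃ d : ℕ → ℕ, (∀ i, 0 < d i ∧ d i ≤ α.parts 1) ∧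
      ∀ C i, 0 < C → C ≤ α.parts 1 → Dfc α A C i = if a ≤ i ∧ i < b ∧ d i = C then 1 else 0 := by
  have hα : 0 < α.parts 1 := by
    have := α.antitone (show 0 < 1 by omega) (show 1 ≤ a from hs.a_pos)
    have := hs.rem
    omega
  have key : ∀ i, ∃ d, (0 < d ∧ d ≤ α.parts 1) ∧
      ∀ C, 0 < C → C ≤ α.parts 1 → Dfc α A C i = if a ≤ i ∧ i < b ∧ d = C then 1 else 0 := by
    intro i
    have hsum := Dfc_sum hs hinj hty i
    by_cases hi : a ≤ i ∧ i < b
    · rw [if_pos hi] at hsum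
      have : ∃ d ∈ Finset.Icc 1 (α.parts 1), Dfc α A d i ≠ 0 := by
        by_contra h
        push Not at h
        rw [Finset.sum_eq_zero h] at hsum
        omega
      obtain ⟨d, hd, hd0⟩ := this
      rw [← Finset.add_sum_erase _ _ hd] at hsum
      have hn := Dfc_nonneg (α := α) A d i
      have hn2 : 0 ≤ ∑ C ∈ (Finset.Icc 1 (α.parts 1)).erase d, Dfc α A C i :=
        Finset.sum_nonneg fun C _ => Dfc_nonneg A C i
      have hz : ∑ C ∈ (Finset.Icc 1 (α.parts 1)).erase d, Dfc α A C i = 0 := by omega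
      rw [Finset.sum_eq_zero_iff_of_nonneg (fun C _ => Dfc_nonneg A C i)] at hz
      refine ⟨d, by rw [Finset.mem_Icc] at hd; omega, fun C hC hC' => ?_⟩
      by_cases hdC : d = C
      · rw [if_pos ⟨hi.1, hi.2, hdC⟩, ← hdC]
        omega
      · rw [if_neg (fun h => hdC h.2.2)]
        exact hz C (Finset.mem_erase.2 ⟨fun h => hdC h.symm, Finset.mem_Icc.2 ⟨hC, hC'⟩⟩)
    · rw [if_neg hi] at hsum
      rw [Finset.sum_eq_zero_iff_of_nonneg (fun C _ => Dfc_nonneg A C i)] at hsum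
      refine ⟨1, by omega, fun C hC hC' => ?_⟩
      rw [if_neg (fun h => hi ⟨h.1, h.2.1⟩)]
      exact hsum C (Finset.mem_Icc.2 ⟨hC, hC'⟩)
  choose d hd1 hd2 using key
  exact ⟨d, hd1, fun C i => hd2 i C⟩

lemma W_zero (hW : GoodW α ct W) {β : Partition n} (hct : ct = β.parts) {a b : ℕ}
    (hs : OneBoxShift α β a b)
    (h0 : ∀ X, IsSSSet α a b X → Uw W α b X = 0) (A : ℕ × ℕ → ℕ) : W A = 0 := by
  classical
  subst hct
  by_contra hA
  have ha := hs.a_pos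
  have hab := hs.a_lt_b
  have hty := hW.content A hA
  have hinj : ∀ p ∈ α.cells, ∀ q ∈ α.cells, p.2 = q.2 → A p = A q → p = q := by
    intro p hp q hq h1 h2
    by_contra h
    exact hA (hW.rep A p q hp hq h h1 h2)
  obtain ⟨d, hd, hD⟩ := exists_d hs hinj hty
  have step : ∀ C i, 0 < C → C ≤ α.parts 1 →
      ((if a ≤ i + 1 ∧ i + 1 < b ∧ d (i + 1) = C then 1 else 0 : ℤ)
        = (if a ≤ i ∧ i < b ∧ d i = C then 1 else 0) + ((if (i + 1, C) ∈ α.cells then 1 else 0)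
          - (if InCol α A C (i + 1) then 1 else 0))) := by
    intro C i h1 h2
    rw [← hD C _ h1 h2, ← hD C _ h1 h2]
    exact Dfc_succ A C i
  set X := (Finset.Ico a b).filter (fun i => i = a ∨ d (i - 1) ≠ d i) with hXdef
  have hmem : ∀ i, i ∈ X ↔ (a ≤ i ∧ i < b) ∧ (i = a ∨ d (i - 1) ≠ d i) := by
    intro i; simp [hXdef]
  have hX : ∀ x ∈ X, a ≤ x ∧ x < b := fun x hx => ((hmem x).1 hx).1
  have hXb : ∀ x ∈ X, x < b := fun x hx => (hX x hx).2
  have haX : a ∈ X := (hmem a).2 ⟨⟨le_rfl, hab⟩, Or.inl rfl⟩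
  -- `d` is constant on the gaps
  have hconst : ∀ x ∈ X, ∀ k, x + k < nextIn X b x → d (x + k) = d x := by
    intro x hx k
    induction k with
    | zero => simp
    | succ k ih =>
      intro hk
      rw [← ih (by omega)]
      by_contra h
      obtain ⟨g1, g2, g3, g4⟩ := nextIn_mem hXb (hXb x hx)
      have := hX x hx
      have := g4 (x + (k + 1)) ((hmem _).2 ⟨by omega, Or.inr (by
        rw [show x + (k + 1) - 1 = x + k by omega]; exact fun h' => h h'.symm)⟩) (by omega)
      omega
  have hstart : ∀ x ∈ X, (x, d x) ∈ α.cells ∧ ¬ InCol α A (d x) x := by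
    intro x hx
    obtain ⟨⟨h1, h2⟩, h3⟩ := (hmem x).1 hx
    have := step (d x) (x - 1) (hd x).1 (hd x).2
    rw [show x - 1 + 1 = x by omega, if_pos ⟨h1, h2, rfl⟩, if_neg (by
      rintro ⟨k1, k2, k3⟩
      rcases h3 with h3 | h3
      · omega
      · exact h3 k3)] at this
    constructor
    · by_contra h
      rw [if_neg h] at this
      split_ifs at this <;> omega
    · intro h
      rw [if_pos h] at this
      split_ifs at this <;> omega
  have hG : GoodC α a b X d := by
    refine ⟨haX, hX, fun x hx => ⟨(hstart x hx).1.2.2, ?_⟩⟩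
    obtain ⟨g1, g2, g3, g4⟩ := nextIn_mem hXb (hXb x hx)
    have hxa := hX x hx
    have e := hconst x hx (nextIn X b x - 1 - x) (by omega)
    rw [show x + (nextIn X b x - 1 - x) = nextIn X b x - 1 by omega] at e
    have := step (d x) (nextIn X b x - 1) (hd x).1 (hd x).2
    rw [show nextIn X b x - 1 + 1 = nextIn X b x by omega, if_neg (by
      rintro ⟨k1, k2, k3⟩
      rcases ((hmem _).1 (g3.resolve_right (by omega))).2 with h | h
      · omega
      · exact h (by rw [e, k3])), if_pos ⟨by omega, by omega, e⟩] at this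
    have hnc : (nextIn X b x, d x) ∉ α.cells := by
      intro h
      rw [if_pos h] at this
      split_ifs at this <;> omega
    by_contra h
    exact hnc ⟨by simp only; omega, (hd x).1, by simp only; omega⟩
  have hN := good_zero hW hs h0 _ 0 rfl X d hG (by intro x _ h; omega)
  have hback : ∀ m, a + m < b → ∃ x ∈ X, x ≤ a + m ∧ a + m < nextIn X b x := by
    intro m hm
    by_cases h : a + m ∈ X
    · exact ⟨_, h, le_rfl, (nextIn_mem hXb hm).1⟩
    · have : m ≠ 0 := by rintro rfl; exact h haX
      obtain ⟨l, hl, h1, h2⟩ := exists_pred hXb haX (show a < a + m by omega) hm h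
      exact ⟨l, hl, h1.le, h2⟩
  -- the column permutation
  have hs' : ∀ p : ℕ × ℕ, ∃ q : ℕ × ℕ, p ∈ α.cells → q ∈ α.cells ∧ q.2 = p.2 ∧ Nf X b d q = A p := by
    rintro ⟨r, C⟩
    by_cases hp : (r, C) ∈ α.cells
    · have hC : 0 < C ∧ C ≤ α.parts 1 := by
        have h1 := α.antitone (show 0 < 1 by omega) (show 1 ≤ r from hp.1)
        have h2 := hp.2.2
        have h3 := hp.2.1
        simp only at h2 h3
        omega
      have hin : InCol α A C (A (r, C)) := ⟨r, hp, rfl⟩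
      have hv0 : 0 < A (r, C) := by
        by_contra h
        have h1 := hty 0
        rw [β.parts_zero, Finset.card_eq_zero] at h1
        have : (r, C) ∈ (cellFinset α).filter (fun cc => A cc = 0) := by
          simp only [Finset.mem_filter, mem_cellFinset]
          exact ⟨hp, by omega⟩
        rw [h1] at this
        simp at this
      set v := A (r, C) with hv
      by_cases hvC : (v, C) ∈ α.cells
      · refine ⟨(v, C), fun _ => ⟨hvC, rfl, ?_⟩⟩
        apply Nf_neg
        intro hvX h
        apply (hstart v hvX).2
        rw [← h]; exact hin
      · have := step C (v - 1) hC.1 hC.2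
        rw [show v - 1 + 1 = v by omega, if_neg hvC, if_pos hin] at this
        have h1 : a ≤ v - 1 ∧ v - 1 < b ∧ d (v - 1) = C := by
          by_contra h
          rw [if_neg h] at this
          split_ifs at this <;> omega
        rw [if_pos h1] at this
        have h2 : ¬ (a ≤ v ∧ v < b ∧ d v = C) := by
          intro h
          rw [if_pos h] at this
          omega
        obtain ⟨x, hx, hx1, hx2⟩ := hback (v - 1 - a) (by omega)
        rw [show a + (v - 1 - a) = v - 1 by omega] at hx1 hx2
        have hdx : d x = C := by
          have := hconst x hx (v - 1 - x) (by omega)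
          rw [show x + (v - 1 - x) = v - 1 by omega] at this
          rw [← this]; exact h1.2.2
        obtain ⟨g1, g2, g3, g4⟩ := nextIn_mem hXb (hXb x hx)
        have hnx : nextIn X b x = v := by
          by_cases hvb : v = b
          · omega
          · apply le_antisymm _ (by omega)
            apply g4 v _ (by omega)
            refine (hmem v).2 ⟨by omega, Or.inr ?_⟩
            intro h
            exact h2 ⟨by omega, by omega, by rw [← h]; exact h1.2.2⟩
        refine ⟨(x, C), fun _ => ⟨by rw [← hdx]; exact (hstart x hx).1, rfl, ?_⟩⟩
        rw [Nf_pos hx hdx.symm, hnx]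
    · exact ⟨(0, 0), fun h => absurd h hp⟩
  choose s hs1 using hs'
  apply hA
  refine hW.perm (Nf X b d) A s (fun p hp => ⟨(hs1 p hp).1, (hs1 p hp).2.1⟩) ?_
    (fun p hp => (hs1 p hp).2.2.symm) hN
  intro p hp q hq hpq
  apply hinj p hp q hq
  · rw [← (hs1 p hp).2.1, ← (hs1 q hq).2.1, hpq]
  · rw [← (hs1 p hp).2.2, ← (hs1 q hq).2.2, hpq]

end Vanishing

section Semistandard

variable {α β : Partition n} {a b : ℕ}

lemma IsSSSet.lt {X : Finset ℕ} (h : IsSSSet α a b X) (hb : 0 < b) : ∀ x ∈ X, x < b := by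
  intro x hx
  have := h.2.1 x hx
  omega

lemma chain_compare (ha : 0 < a) (hab : a < b) {X X' : Finset ℕ} {c' : ℕ → ℕ}
    (hX : IsSSSet α a b X) (hX' : IsSSSet α a b X') (hc' : ∀ x ∈ X', c' x ≤ α.parts x)
    (H : ∀ x ∈ X, ∀ i, x ≤ i → i < nextIn X b x →
      ∃ r ∈ X', c' r = α.parts x ∧ r ≤ i ∧ i < nextIn X' b r) :
    X = X' ∧ ∀ x ∈ X, c' x = α.parts x := by
  have hXb := hX.lt (by omega)
  have hXb' := hX'.lt (by omega)
  have uniq : ∀ r ∈ X', ∀ r' ∈ X', ∀ i, r ≤ i → i < nextIn X' b r → r' ≤ i →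
      i < nextIn X' b r' → r = r' := by
    intro r hr r' hr' i h1 h2 h3 h4
    rcases lt_trichotomy r r' with h | h | h
    · have := (nextIn_mem hXb' (hXb' r hr)).2.2.2 r' hr' h; omega
    · exact h
    · have := (nextIn_mem hXb' (hXb' r' hr')).2.2.2 r hr h; omega
  have key : ∀ i, i ∈ X ↔ i ∈ X' := by
    intro i
    induction i using Nat.strong_induction_on with
    | _ i ih =>
    constructor
    · intro hi
      by_contra hi'
      obtain ⟨r, hr, hr1, hr2, hr3⟩ := H i hi i le_rfl (nextIn_mem hXb (hXb i hi)).1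
      have hri : r < i := lt_of_le_of_ne hr2 (fun h => hi' (h ▸ hr))
      have hrX := (ih r hri).2 hr
      obtain ⟨g1, g2, g3, g4⟩ := nextIn_mem hXb (hXb r hrX)
      obtain ⟨k1, k2, k3, k4⟩ := nextIn_mem hXb' (hXb' r hr)
      have hn : i - 1 < nextIn X b r := by
        by_contra h
        have hib := hXb i hi
        have h1 := g3.resolve_right (by omega)
        have h2 := (ih _ (by omega)).1 h1
        have := k4 _ h2 g1
        omega
      obtain ⟨r2, hr2', e1, e2, e3⟩ := H r hrX (i - 1) (by omega) hn
      have := uniq r2 hr2' r hr (i - 1) e2 e3 (by omega) (by omega)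
      subst this
      have hra := (hX'.2.1 r2 hr)
      have h1 := α.antitone (show 0 < r2 + 1 by omega) (show r2 + 1 ≤ i by omega)
      have h2 := α.antitone (show 0 < r2 by omega) (show r2 ≤ r2 + 1 by omega)
      have h3 := hX'.2.2 r2 hr (by omega)
      have := k4 _ h3 (by omega)
      omega
    · intro hi
      by_contra hi'
      have hia := hX'.2.1 i hi
      have hai : a < i := lt_of_le_of_ne hia.1 (fun h => hi' (h ▸ hX.1))
      obtain ⟨x, hx, hxi, hin⟩ := exists_pred hXb hX.1 hai (by omega) hi'
      obtain ⟨r, hr, hr1, hr2, hr3⟩ := H x hx i hxi.le hin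
      have := uniq r hr i hi i hr2 hr3 le_rfl (nextIn_mem hXb' (hXb' i hi)).1
      subst this
      have h0 := hc' r hi
      have hxa := hX.2.1 x hx
      have h1 := α.antitone (show 0 < x + 1 by omega) (show x + 1 ≤ r by omega)
      have h2 := α.antitone (show 0 < x by omega) (show x ≤ x + 1 by omega)
      have h3 := hX.2.2 x hx (by omega)
      have := (nextIn_mem hXb (hXb x hx)).2.2.2 _ h3 (by omega)
      omega
  have hXX : X = X' := Finset.ext key
  refine ⟨hXX, fun x hx => ?_⟩
  have hx' := (key x).1 hx
  obtain ⟨r, hr, hr1, hr2, hr3⟩ := H x hx x le_rfl (nextIn_mem hXb (hXb x hx)).1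
  rw [← hr1, uniq r hr x hx' x hr2 hr3 le_rfl (nextIn_mem hXb' (hXb' x hx')).1]

/-- The cells in the first `i` rows with entry larger than `i`. -/
noncomputable def Ex (α : Partition n) (w : ℕ × ℕ → ℕ) (i : ℕ) : Finset (ℕ × ℕ) :=
  (cellFinset α).filter (fun p => p.1 ≤ i ∧ i < w p)

lemma row_card (α : Partition n) (r : ℕ) :
    ((cellFinset α).filter (fun p => p.1 = r)).card = α.parts r := by
  have : ((cellFinset α).filter (fun p => p.1 = r)).card = (Finset.Icc 1 (α.parts r)).card := by
    apply Finset.card_bij (fun p _ => p.2)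
    · rintro ⟨i, j⟩ hp
      simp only [Finset.mem_filter, mem_cellFinset, mem_cells] at hp
      obtain ⟨hp, rfl⟩ := hp
      simp only [Finset.mem_Icc]; omega
    · rintro ⟨i, j⟩ hp ⟨i', j'⟩ hq h
      simp only [Finset.mem_filter] at hp hq
      simp only at h
      rw [h, hp.2, hq.2]
    · intro j hj
      rw [Finset.mem_Icc] at hj
      refine ⟨(r, j), ?_, rfl⟩
      simp only [Finset.mem_filter, mem_cellFinset, mem_cells, and_true]
      refine ⟨?_, hj⟩
      by_contra h
      have : r = 0 := by omega
      rw [this, α.parts_zero] at hj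
      omega
  rw [this, Nat.card_Icc]; omega

lemma shift_sum (hs : OneBoxShift α β a b) (i : ℕ) :
    ∑ v ∈ Finset.Icc 1 i, ((α.parts v : ℤ) - β.parts v) = if a ≤ i ∧ i < b then 1 else 0 := by
  have ha := hs.a_pos
  have hab := hs.a_lt_b
  induction i with
  | zero => simp; omega
  | succ i ih =>
    rw [Finset.sum_Icc_succ_top (by omega), ih]
    have h1 := hs.at_a
    have h2 := hs.at_b
    have h3 := hs.elsewhere (i + 1)
    have h4 := hs.rem
    by_cases ha' : i + 1 = a
    · rw [ha', h1]
      split_ifs <;> omega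
    · by_cases hb' : i + 1 = b
      · rw [hb', h2]
        split_ifs <;> omega
      · rw [h3 ha' hb']
        split_ifs <;> omega

lemma Ex_card (hs : OneBoxShift α β a b) {w : ℕ × ℕ → ℕ} (hty : IsTypeOf α β.parts w)
    (hw : ∀ p ∈ α.cells, p.1 ≤ w p) (i : ℕ) :
    (Ex α w i).card = if a ≤ i ∧ i < b then 1 else 0 := by
  classical
  have h1 : ((cellFinset α).filter (fun p => p.1 ≤ i)).card = ∑ v ∈ Finset.Icc 1 i, α.parts v := by
    rw [Finset.card_eq_sum_card_fiberwise (f := fun p => p.1) (t := Finset.Icc 1 i)]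
    · refine Finset.sum_congr rfl fun v hv => ?_
      rw [← row_card α v, Finset.filter_filter]
      congr 1
      ext p
      simp only [Finset.mem_filter, Finset.mem_Icc] at hv ⊢
      constructor
      · rintro ⟨h1, h2, h3⟩; exact ⟨h1, h3⟩
      · rintro ⟨h1, h3⟩; exact ⟨h1, by omega, h3⟩
    · intro p hp
      simp only [Finset.coe_filter, Set.mem_setOf_eq, mem_cellFinset] at hp
      simp only [Finset.coe_Icc, Set.mem_Icc]
      exact ⟨hp.1.1, hp.2⟩
  have h2 : ((cellFinset α).filter (fun p => w p ≤ i)).card = ∑ v ∈ Finset.Icc 1 i, β.parts v := by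
    rw [Finset.card_eq_sum_card_fiberwise (f := w) (t := Finset.Icc 1 i)]
    · refine Finset.sum_congr rfl fun v hv => ?_
      rw [← hty v, Finset.filter_filter]
      congr 1
      ext p
      simp only [Finset.mem_filter, Finset.mem_Icc] at hv ⊢
      constructor
      · rintro ⟨h1, h2, h3⟩; exact ⟨h1, h3⟩
      · rintro ⟨h1, h3⟩; exact ⟨h1, by omega, h3⟩
    · intro p hp
      simp only [Finset.coe_filter, Set.mem_setOf_eq, mem_cellFinset] at hp
      simp only [Finset.coe_Icc, Set.mem_Icc]
      have h1 := hw p hp.1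
      have h2 : 0 < p.1 := hp.1.1
      exact ⟨by omega, hp.2⟩
  have h3 : ((cellFinset α).filter (fun p => p.1 ≤ i)).card
      = ((cellFinset α).filter (fun p => w p ≤ i)).card + (Ex α w i).card := by
    rw [← Finset.card_union_of_disjoint]
    · congr 1
      ext p
      simp only [Ex, Finset.mem_union, Finset.mem_filter, mem_cellFinset]
      constructor
      · rintro ⟨h1, h2⟩
        by_cases h : w p ≤ i
        · exact Or.inl ⟨h1, h⟩
        · exact Or.inr ⟨h1, h2, by omega⟩
      · rintro (⟨h1, h2⟩ | ⟨h1, h2, h3⟩)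
        · exact ⟨h1, (hw p h1).trans h2⟩
        · exact ⟨h1, h2⟩
    · rw [Finset.disjoint_left]
      intro p
      simp only [Ex, Finset.mem_filter]
      omega
  have h4 := shift_sum hs i
  rw [Finset.sum_sub_distrib] at h4
  rw [h1, h2] at h3
  have h5 : (∑ v ∈ Finset.Icc 1 i, (α.parts v : ℤ)) = ∑ v ∈ Finset.Icc 1 i, (β.parts v : ℤ)
      + (Ex α w i).card := by exact_mod_cast h3
  split_ifs at h4 ⊢ <;> omega

lemma classify (hs : OneBoxShift α β a b) {w : ℕ × ℕ → ℕ} (hty : IsTypeOf α β.parts w)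
    (hw : ∀ p ∈ α.cells, p.1 ≤ w p) :
    ∃ (X : Finset ℕ) (c : ℕ → ℕ), a ∈ X ∧ (∀ x ∈ X, a ≤ x ∧ x < b) ∧
      (∀ x ∈ X, (x, c x) ∈ α.cells) ∧ (∀ p ∈ α.cells, w p = Nf X b c p) := by
  classical
  have ha := hs.a_pos
  have hab := hs.a_lt_b
  have hE := Ex_card hs hty hw
  have mE : ∀ r s i, (r, s) ∈ Ex α w i ↔ (r, s) ∈ α.cells ∧ r ≤ i ∧ i < w (r, s) := by
    intro r s i; simp [Ex, mem_cellFinset]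
  have uniq : ∀ p q i, p ∈ Ex α w i → q ∈ Ex α w i → p = q := by
    intro p q i hp hq
    have h1 : (Ex α w i).card ≤ 1 := by rw [hE]; split_ifs <;> omega
    exact Finset.card_le_one.1 h1 p hp q hq
  have inr : ∀ p i, p ∈ Ex α w i → a ≤ i ∧ i < b := by
    intro p i hp
    by_contra h
    have h1 := hE i
    rw [if_neg h, Finset.card_eq_zero] at h1
    rw [h1] at hp; simp at hp
  have ne : ∀ i, a ≤ i → i < b → ∃ r s, (r, s) ∈ Ex α w i := by
    intro i h1 h2
    have h3 := hE i
    rw [if_pos ⟨h1, h2⟩] at h3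
    obtain ⟨⟨r, s⟩, hp⟩ := Finset.card_pos.1 (show 0 < (Ex α w i).card by omega)
    exact ⟨r, s, hp⟩
  set X := (Finset.Ico a b).filter (fun r => ∃ s, (r, s) ∈ Ex α w r) with hXdef
  have hmem : ∀ r, r ∈ X ↔ ∃ s, (r, s) ∈ Ex α w r := by
    intro r
    simp only [hXdef, Finset.mem_filter, Finset.mem_Ico, and_iff_right_iff_imp]
    rintro ⟨s, hsx⟩
    exact inr _ _ hsx
  have hX : ∀ x ∈ X, a ≤ x ∧ x < b := by
    intro x hx
    obtain ⟨s, hsx⟩ := (hmem x).1 hx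
    exact inr _ _ hsx
  have hch : ∀ r, ∃ s, r ∈ X → (r, s) ∈ Ex α w r := by
    intro r
    by_cases h : r ∈ X
    · obtain ⟨s, hsx⟩ := (hmem r).1 h
      exact ⟨s, fun _ => hsx⟩
    · exact ⟨0, fun h' => absurd h' h⟩
  choose c hc using hch
  refine ⟨X, c, ?_, hX, fun x hx => ((mE _ _ _).1 (hc x hx)).1, ?_⟩
  · obtain ⟨r, s, hrs⟩ := ne a le_rfl hab
    have h1 := (mE _ _ _).1 hrs
    have : r = a := by
      by_contra h
      have := inr (r, s) (a - 1) ((mE _ _ _).2 ⟨h1.1, by omega, by omega⟩)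
      omega
    subst this
    exact (hmem r).2 ⟨s, hrs⟩
  · rintro ⟨r, s⟩ hp
    by_cases hr : r ∈ X ∧ s = c r
    · obtain ⟨hr, rfl⟩ := hr
      rw [Nf_pos hr rfl]
      symm
      obtain ⟨_, _, h2⟩ := (mE _ _ _).1 (hc r hr)
      have hvb : w (r, c r) ≤ b := by
        by_contra h
        have := inr (r, c r) b ((mE _ _ _).2 ⟨hp, (hX r hr).2.le, by omega⟩)
        omega
      apply nextIn_eq h2 _ hvb
      · intro y hy hry
        by_contra h
        have := uniq _ _ y (hc y hy) ((mE r (c r) y).2 ⟨hp, hry.le, by omega⟩)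
        simp only [Prod.mk.injEq] at this
        omega
      · by_cases hvb' : w (r, c r) = b
        · exact Or.inr hvb'
        · left
          have hra := hX r hr
          obtain ⟨r', s', hrs⟩ := ne (w (r, c r)) (by omega) (by omega)
          have h3 := (mE _ _ _).1 hrs
          have : r' = w (r, c r) := by
            by_contra h
            have := uniq _ _ (w (r, c r) - 1) ((mE r' s' _).2 ⟨h3.1, by omega, by omega⟩)
              ((mE r (c r) _).2 ⟨hp, by omega, by omega⟩)
            simp only [Prod.mk.injEq] at this
            obtain ⟨rfl, rfl⟩ := this
            omega
          rw [this] at hrs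
          exact (hmem _).2 ⟨s', hrs⟩
    · rw [Nf_neg (fun h h' => hr ⟨h, h'⟩)]
      have h1 := hw _ hp
      simp only at h1
      by_contra h
      have h2 : (r, s) ∈ Ex α w r := (mE _ _ _).2 ⟨hp, le_rfl, by omega⟩
      have h3 : r ∈ X := (hmem r).2 ⟨s, h2⟩
      have := uniq _ _ r h2 (hc r h3)
      simp only [Prod.mk.injEq, true_and] at this
      exact hr ⟨h3, this⟩

lemma parts_pos (hs : OneBoxShift α β a b) {x : ℕ} (h0 : 0 < x) (hx : x < b) :
    0 < α.parts x := by
  have h1 := hs.add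
  have h2 := α.antitone h0 (show x ≤ b - 1 by omega)
  omega

lemma tableauOfSet_eq (hs : OneBoxShift α β a b) {X : Finset ℕ} (hX : IsSSSet α a b X) :
    ∀ p ∈ α.cells, tableauOfSet α a b X p = Nf X b α.parts p := by
  rintro ⟨r, s⟩ hp
  unfold tableauOfSet
  rw [if_pos hp]
  simp only
  by_cases h : r ∈ X ∧ s = α.parts r
  · have := hX.2.1 r h.1
    rw [if_pos ⟨this.1, this.2, h.2⟩, Nf_pos h.1 h.2, hatOfSet, if_pos h.1]
  · rw [Nf_neg (fun h1 h2 => h ⟨h1, h2⟩)]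
    split_ifs with h1
    · rw [hatOfSet, if_neg (fun h2 => h ⟨h2, h1.2.2⟩)]
    · rfl

lemma Nf_ge {X : Finset ℕ} {c : ℕ → ℕ} (hXb : ∀ x ∈ X, x < b) (p : ℕ × ℕ) : p.1 ≤ Nf X b c p := by
  obtain ⟨r, s⟩ := p
  by_cases h : r ∈ X ∧ s = c r
  · rw [Nf_pos h.1 h.2]
    exact (nextIn_mem hXb (hXb r h.1)).1.le
  · rw [Nf_neg (fun h1 h2 => h ⟨h1, h2⟩)]

lemma Nf_col (hs : OneBoxShift α β a b) {X : Finset ℕ} (hX : IsSSSet α a b X) {i i' j : ℕ}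
    (h1 : (i, j) ∈ α.cells) (h2 : (i', j) ∈ α.cells) (hii : i < i') :
    Nf X b α.parts (i, j) < Nf X b α.parts (i', j) := by
  have hab := hs.a_lt_b
  have hXb := hX.lt (by omega)
  have hge := Nf_ge (c := α.parts) hXb (i', j)
  simp only at hge
  by_cases h : i ∈ X ∧ j = α.parts i
  · obtain ⟨hi, rfl⟩ := h
    rw [Nf_pos hi rfl]
    have e0 := h1.1
    have e1 := h2.2.2
    simp only at e0 e1
    have e2 := α.antitone (show 0 < i + 1 by omega) (show i + 1 ≤ i' by omega)
    have e3 := α.antitone e0 (show i ≤ i + 1 by omega)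
    have e4 := hX.2.2 i hi (by omega)
    have e5 := (nextIn_mem hXb (hXb i hi)).2.2.2 _ e4 (by omega)
    by_cases e6 : i' = i + 1
    · subst e6
      rw [Nf_pos e4 (by omega)]
      have := (nextIn_mem hXb (hXb _ e4)).1
      omega
    · omega
  · rw [Nf_neg (fun h1 h2 => h ⟨h1, h2⟩)]
    omega

lemma Nf_type (hs : OneBoxShift α β a b) {X : Finset ℕ} (hX : IsSSSet α a b X) :
    IsTypeOf α β.parts (Nf X b α.parts) := by
  classical
  have ha := hs.a_pos
  have hab := hs.a_lt_b
  have hXb := hX.lt (by omega)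
  have hpos : ∀ x ∈ X, 0 < α.parts x := by
    intro x hx
    have := hX.2.1 x hx
    exact parts_pos hs (by omega) (by omega)
  intro j
  have e : (cellFinset α).filter (fun p => Nf X b α.parts p = j)
      = ((cellFinset α).filter (fun p => p.1 = j)).filter (fun p => ¬ (j ∈ X ∧ p.2 = α.parts j))
        ∪ (X.filter (fun x => nextIn X b x = j)).image (fun x => (x, α.parts x)) := by
    ext ⟨r, s⟩
    simp only [Finset.mem_filter, Finset.mem_union, Finset.mem_image, mem_cellFinset,
      Prod.mk.injEq]
    by_cases h : r ∈ X ∧ s = α.parts r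
    · obtain ⟨hr, rfl⟩ := h
      rw [Nf_pos hr rfl]
      constructor
      · rintro ⟨h1, h2⟩
        exact Or.inr ⟨r, ⟨hr, h2⟩, rfl, rfl⟩
      · rintro (⟨⟨h1, rfl⟩, h3⟩ | ⟨x, ⟨h1, h2⟩, rfl, h4⟩)
        · exact absurd ⟨hr, rfl⟩ h3
        · have := hX.2.1 x hr
          exact ⟨⟨by simp only; omega, hpos x hr, le_rfl⟩, h2⟩
    · rw [Nf_neg (fun h1 h2 => h ⟨h1, h2⟩)]
      constructor
      · rintro ⟨h1, rfl⟩
        exact Or.inl ⟨⟨h1, rfl⟩, h⟩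
      · rintro (⟨⟨h1, rfl⟩, h3⟩ | ⟨x, ⟨h1, h2⟩, rfl, h4⟩)
        · exact ⟨h1, rfl⟩
        · exact absurd ⟨h1, h4.symm⟩ h
  have hdisj : Disjoint
      (((cellFinset α).filter (fun p => p.1 = j)).filter (fun p => ¬ (j ∈ X ∧ p.2 = α.parts j)))
      ((X.filter (fun x => nextIn X b x = j)).image (fun x => (x, α.parts x))) := by
    rw [Finset.disjoint_left]
    rintro ⟨r, s⟩
    simp only [Finset.mem_filter, Finset.mem_image, Prod.mk.injEq]
    rintro ⟨⟨_, rfl⟩, h⟩ ⟨x, ⟨h1, h2⟩, rfl, h4⟩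
    exact h ⟨h1, h4.symm⟩
  have c1 : (((cellFinset α).filter (fun p => p.1 = j)).filter
      (fun p => ¬ (j ∈ X ∧ p.2 = α.parts j))).card = if j ∈ X then α.parts j - 1 else α.parts j := by
    split_ifs with hj
    · have hja := hX.2.1 j hj
      have : ((cellFinset α).filter (fun p => p.1 = j)).filter
          (fun p => ¬ (j ∈ X ∧ p.2 = α.parts j))
          = ((cellFinset α).filter (fun p => p.1 = j)).erase (j, α.parts j) := by
        ext ⟨r, s⟩
        simp only [Finset.mem_filter, Finset.mem_erase, ne_eq, Prod.mk.injEq]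
        constructor
        · rintro ⟨⟨h1, h2⟩, h3⟩
          exact ⟨fun h => h3 ⟨hj, h.2⟩, h1, h2⟩
        · rintro ⟨h1, h2, h3⟩
          exact ⟨⟨h2, h3⟩, fun h => h1 ⟨h3, h.2⟩⟩
      rw [this, Finset.card_erase_of_mem, row_card]
      simp only [Finset.mem_filter, mem_cellFinset, and_true]
      exact ⟨by simp only; omega, hpos j hj, le_rfl⟩
    · rw [Finset.filter_true_of_mem, row_card]
      intro p _ h
      exact hj h.1
  have c2 : (X.filter (fun x => nextIn X b x = j)).card
      = if (j ∈ X ∧ j ≠ a) ∨ j = b then 1 else 0 := by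
    split_ifs with hj
    · have haj : a < j := by
        rcases hj with ⟨h1, h2⟩ | rfl
        · have := hX.2.1 j h1; omega
        · exact hab
      have hjb : j ≤ b := by
        rcases hj with ⟨h1, h2⟩ | rfl
        · exact (hXb j h1).le
        · exact le_rfl
      have hne : (X.filter (· < j)).Nonempty := ⟨a, by simp [hX.1, haj]⟩
      have hm := Finset.max'_mem _ hne
      have hM := fun x hx => Finset.le_max' (X.filter (· < j)) x hx
      set l := (X.filter (· < j)).max' hne
      simp only [Finset.mem_filter] at hm hM
      rw [Finset.card_eq_one]
      refine ⟨l, ?_⟩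
      have hln : nextIn X b l = j := by
        apply nextIn_eq hm.2 _ hjb
        · intro w hw hlw
          by_contra h
          have := hM w ⟨hw, by omega⟩
          omega
        · tauto
      ext x
      simp only [Finset.mem_filter, Finset.mem_singleton]
      constructor
      · rintro ⟨h1, h2⟩
        obtain ⟨g1, g2, g3, g4⟩ := nextIn_mem hXb (hXb x h1)
        have := hM x ⟨h1, by omega⟩
        by_contra h
        have := g4 l hm.1 (by omega)
        omega
      · rintro rfl
        exact ⟨hm.1, hln⟩
    · rw [Finset.card_eq_zero, Finset.filter_eq_empty_iff]
      intro x hx h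
      obtain ⟨g1, g2, g3, g4⟩ := nextIn_mem hXb (hXb x hx)
      have := hX.2.1 x hx
      rw [h] at g1 g3
      apply hj
      rcases g3 with g3 | g3
      · exact Or.inl ⟨g3, by omega⟩
      · exact Or.inr g3
  rw [e, Finset.card_union_of_disjoint hdisj, c1, Finset.card_image_of_injective, c2]
  · by_cases ja : j = a
    · subst ja
      rw [if_pos hX.1, if_neg (by simp; omega), hs.at_a, add_zero]
    · by_cases jb : j = b
      · subst jb
        rw [if_neg (fun h => absurd (hXb _ h) (lt_irrefl _)), if_pos (Or.inr rfl), hs.at_b]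
      · rw [hs.elsewhere j ja jb]
        by_cases hj : j ∈ X
        · rw [if_pos hj, if_pos (Or.inl ⟨hj, ja⟩)]
          have := hpos j hj
          omega
        · rw [if_neg hj, if_neg (by tauto)]
          omega
  · intro x y h
    exact (Prod.mk.inj h).1

lemma isTypeOf_congr {c : ℕ → ℕ} {T S : ℕ × ℕ → ℕ} (h : ∀ p ∈ α.cells, T p = S p)
    (hS : IsTypeOf α c S) : IsTypeOf α c T := by
  intro j
  rw [← hS j]
  congr 1
  refine Finset.filter_congr fun p hp => ?_
  rw [h p (mem_cellFinset.1 hp)]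

lemma mem_sst {T : ℕ × ℕ → ℕ} : T ∈ sstFinset α β ↔ T ∈ SSTSet α β.parts := by
  simp [sstFinset]

lemma tableauOfSet_mem (hs : OneBoxShift α β a b) {X : Finset ℕ} (hX : IsSSSet α a b X) :
    tableauOfSet α a b X ∈ sstFinset α β := by
  have hab := hs.a_lt_b
  have hXb := hX.lt (by omega)
  have he := tableauOfSet_eq hs hX
  refine mem_sst.2 ⟨⟨?_, ?_⟩, isTypeOf_congr he (Nf_type hs hX), ?_⟩
  · intro i j j' h1 h2 hj
    rw [he _ h1, he _ h2]
    by_cases h : i ∈ X ∧ j = α.parts i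
    · have := h2.2.2
      simp only at this
      rw [show j' = j by omega]
    · rw [Nf_neg (fun h1 h2 => h ⟨h1, h2⟩)]
      exact Nf_ge hXb (i, j')
  · intro i i' j h1 h2 hi
    rw [he _ h1, he _ h2]
    exact Nf_col hs hX h1 h2 hi
  · intro p hp
    unfold tableauOfSet
    rw [if_neg hp]

lemma Tset_tableauOfSet (hs : OneBoxShift α β a b) {X : Finset ℕ} (hX : IsSSSet α a b X) :
    Tset α a b (tableauOfSet α a b X) = X := by
  have ha := hs.a_pos
  have hab := hs.a_lt_b
  have hXb := hX.lt (by omega)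
  have he := tableauOfSet_eq hs hX
  ext u
  have hm : u ∈ Tset α a b (tableauOfSet α a b X) ↔
      (a ≤ u ∧ u ≤ b - 1) ∧ tableauOfSet α a b X (u, α.parts u) ≠ u := by
    unfold Tset hatOf
    rw [Finset.mem_filter, Finset.mem_Icc]
  rw [hm]
  constructor
  · rintro ⟨⟨h1, h2⟩, h3⟩
    by_contra h
    apply h3
    rw [he _ ⟨by simp only; omega, parts_pos hs (by omega) (by omega), le_rfl⟩,
      Nf_neg (fun h' => absurd h' h)]
  · intro h
    have h1 := hX.2.1 u h
    refine ⟨h1, ?_⟩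
    rw [he _ ⟨by simp only; omega, parts_pos hs (by omega) (by omega), le_rfl⟩, Nf_pos h rfl]
    have := (nextIn_mem hXb (hXb u h)).1
    omega

lemma sst_ge {T : ℕ × ℕ → ℕ} (hT : T ∈ SSTSet α β.parts) : ∀ p ∈ α.cells, p.1 ≤ T p := by
  rintro ⟨r, s⟩
  induction r with
  | zero => intro _; exact Nat.zero_le _
  | succ r ih =>
    intro hp
    simp only
    have h1 := hp.2.1
    have h2 := hp.2.2
    simp only at h1 h2
    by_cases hr : r = 0
    · subst hr
      by_contra h
      have h3 := hT.2.1 0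
      rw [β.parts_zero, Finset.card_eq_zero] at h3
      have : (0 + 1, s) ∈ (cellFinset α).filter (fun cc => T cc = 0) := by
        simp only [Finset.mem_filter, mem_cellFinset]
        exact ⟨hp, by omega⟩
      rw [h3] at this
      simp at this
    · have h3 : (r, s) ∈ α.cells := by
        have := α.antitone (show 0 < r by omega) (show r ≤ r + 1 by omega)
        exact ⟨by simp only; omega, h1, by simp only; omega⟩
      have h4 := ih h3
      have h5 := hT.1.2 r (r + 1) s h3 hp (by omega)
      simp only at h4
      omega

/-- Every semistandard tableau comes from a semistandard set. -/
lemma sst_classify (hs : OneBoxShift α β a b) {T : ℕ × ℕ → ℕ} (hT : T ∈ sstFinset α β) :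
    ∃ X, IsSSSet α a b X ∧ T = tableauOfSet α a b X := by
  have ha := hs.a_pos
  have hab := hs.a_lt_b
  have hT := mem_sst.1 hT
  obtain ⟨X, c, haX, hX, hc, hw⟩ := classify hs hT.2.1 (sst_ge hT)
  have hXb : ∀ x ∈ X, x < b := fun x hx => (hX x hx).2
  have hcα : ∀ x ∈ X, c x = α.parts x := by
    intro x hx
    have h1 := hX x hx
    have hcell : (x, α.parts x) ∈ α.cells :=
      ⟨by simp only; omega, parts_pos hs (by omega) h1.2, le_rfl⟩
    have h2 := hT.1.1 x (c x) (α.parts x) (hc x hx) hcell (hc x hx).2.2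
    by_contra h
    rw [hw _ (hc x hx), hw _ hcell, Nf_pos hx rfl, Nf_neg (fun _ h' => h h'.symm)] at h2
    have := (nextIn_mem hXb (hXb x hx)).1
    omega
  rw [Nf_congr hcα] at hw
  have hss : IsSSSet α a b X := by
    refine ⟨haX, fun x hx => by have := hX x hx; omega, fun u hu hu1 => ?_⟩
    have h1 := hX u hu
    have hp := parts_pos hs (show 0 < u by omega) h1.2
    have hc1 : (u, α.parts u) ∈ α.cells := ⟨by simp only; omega, hp, le_rfl⟩
    have hc2 : (u + 1, α.parts u) ∈ α.cells := ⟨by simp only; omega, hp, by simp only; omega⟩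
    have h2 := hT.1.2 u (u + 1) _ hc1 hc2 (by omega)
    by_contra h
    rw [hw _ hc1, hw _ hc2, Nf_pos hu rfl, Nf_neg (fun h' => absurd h' h)] at h2
    have := (nextIn_mem hXb (hXb u hu)).1
    omega
  refine ⟨X, hss, ?_⟩
  funext p
  by_cases hp : p ∈ α.cells
  · rw [hw p hp, tableauOfSet_eq hs hss p hp]
  · rw [hT.2.2 p hp]
    unfold tableauOfSet
    rw [if_neg hp]

end Semistandard

section Delta

variable {α β : Partition n} {a b : ℕ}

lemma rowContent_eq (T : ℕ × ℕ → ℕ) (i j : ℕ) :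
    rowContent α T i j = ((cellFinset α).filter (fun p => p.1 = i ∧ T p = j)).card := by
  unfold rowContent
  apply Finset.card_bij (fun s _ => (i, s))
  · intro s hs
    rw [Finset.mem_filter, Finset.mem_Icc] at hs
    rw [Finset.mem_filter, mem_cellFinset, mem_cells]
    refine ⟨⟨?_, hs.1.1, hs.1.2⟩, rfl, hs.2⟩
    rcases Nat.eq_zero_or_pos i with h0 | h0
    · exfalso
      have := α.parts_zero
      rw [h0] at hs
      omega
    · exact h0
  · intro s _ s' _ h
    exact (Prod.ext_iff.1 h).2
  · rintro ⟨r, s⟩ hp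
    rw [Finset.mem_filter, mem_cellFinset, mem_cells] at hp
    obtain ⟨⟨h1, h2, h3⟩, h4, h5⟩ := hp
    simp only at h4
    subst h4
    exact ⟨s, Finset.mem_filter.2 ⟨Finset.mem_Icc.2 ⟨h2, h3⟩, h5⟩, rfl⟩

lemma col_split {f : ℕ × ℕ → ℕ} (hf : ∀ p ∈ α.cells, p.1 ≤ f p) (C i : ℕ) :
    ((cellFinset α).filter (fun p => p.2 = C ∧ p.1 ≤ i)).card
      = ((cellFinset α).filter (fun p => p.2 = C ∧ p.1 ≤ i ∧ i < f p)).card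
        + ((cellFinset α).filter (fun p => p.2 = C ∧ f p ≤ i)).card := by
  rw [← Finset.card_union_of_disjoint]
  · congr 1
    ext p
    simp only [Finset.mem_filter, Finset.mem_union, mem_cellFinset]
    constructor
    · rintro ⟨h1, h2, h3⟩
      by_cases h : i < f p
      · exact Or.inl ⟨h1, h2, h3, h⟩
      · exact Or.inr ⟨h1, h2, by omega⟩
    · rintro (⟨h1, h2, h3, h⟩ | ⟨h1, h2, h3⟩)
      · exact ⟨h1, h2, h3⟩
      · have := hf p h1
        exact ⟨h1, h2, by omega⟩
  · rw [Finset.disjoint_left]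
    intro p h1 h2
    simp only [Finset.mem_filter] at h1 h2
    omega

lemma delta_aux (hs : OneBoxShift α β a b) {X Y : Finset ℕ} (hX : IsSSSet α a b X)
    (hY : IsSSSet α a b Y) (t : Placement α) {π : Equiv.Perm (Fin n)}
    (hπ : ∀ k, (t.pos (π k)).2 = (t.pos k).2)
    (hrow : ∀ i j, (Finset.univ.filter (fun k => (t.pos (π k)).1 = i ∧
      Nf X b α.parts (t.pos k) = j)).card = rowContent α (tableauOfSet α a b Y) i j) :
    π = 1 ∧ X = Y := by
  classical
  have ha := hs.a_pos
  have hab := hs.a_lt_b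
  have hXb := hX.lt (by omega)
  have hYb := hY.lt (by omega)
  have hTe := tableauOfSet_eq hs hY
  set T := tableauOfSet α a b Y with hT
  obtain ⟨w, hw⟩ : ∃ w : ℕ × ℕ → ℕ, ∀ k, w (t.pos (π k)) = Nf X b α.parts (t.pos k) := by
    refine ⟨fun p => if h : ∃ k, t.pos (π k) = p then Nf X b α.parts (t.pos h.choose) else 0, ?_⟩
    intro k
    have h : ∃ l, t.pos (π l) = t.pos (π k) := ⟨k, rfl⟩
    have h2 : h.choose = k := π.injective (t.inj h.choose_spec)
    simp only
    rw [dif_pos h, h2]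
  have cc : ∀ (P : ℕ × ℕ → Prop) [DecidablePred P], ((cellFinset α).filter P).card
      = (Finset.univ.filter (fun k => P (t.pos (π k)))).card := by
    intro P _
    exact card_cells (t.perm π.symm) P
  have hrc : ∀ i j, ((cellFinset α).filter (fun p => p.1 = i ∧ w p = j)).card
      = ((cellFinset α).filter (fun p => p.1 = i ∧ T p = j)).card := by
    intro i j
    rw [← rowContent_eq T, ← hrow, cc]
    simp only [hw]
  have hty : IsTypeOf α β.parts w := by
    intro j
    rw [← Nf_type hs hX j, cc, card_cells t]
    simp only [hw]
  have ex1 : ∀ p ∈ α.cells, ∃ q ∈ α.cells, q.1 = p.1 ∧ T q = w p := by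
    intro p hp
    have h1 : 0 < ((cellFinset α).filter (fun q => q.1 = p.1 ∧ w q = w p)).card :=
      Finset.card_pos.2 ⟨p, Finset.mem_filter.2 ⟨mem_cellFinset.2 hp, rfl, rfl⟩⟩
    rw [hrc] at h1
    obtain ⟨q, hq⟩ := Finset.card_pos.1 h1
    rw [Finset.mem_filter, mem_cellFinset] at hq
    exact ⟨q, hq⟩
  have ex2 : ∀ p ∈ α.cells, ∃ q ∈ α.cells, q.1 = p.1 ∧ w q = T p := by
    intro p hp
    have h1 : 0 < ((cellFinset α).filter (fun q => q.1 = p.1 ∧ T q = T p)).card :=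
      Finset.card_pos.2 ⟨p, Finset.mem_filter.2 ⟨mem_cellFinset.2 hp, rfl, rfl⟩⟩
    rw [← hrc] at h1
    obtain ⟨q, hq⟩ := Finset.card_pos.1 h1
    rw [Finset.mem_filter, mem_cellFinset] at hq
    exact ⟨q, hq⟩
  have hge : ∀ p ∈ α.cells, p.1 ≤ w p := by
    intro p hp
    obtain ⟨q, hq, h1, h2⟩ := ex1 p hp
    rw [← h1, ← h2, hTe q hq]
    exact Nf_ge hYb q
  obtain ⟨X', c', haX', hX', hc', hw'⟩ := classify hs hty hge
  have hXb' : ∀ x ∈ X', x < b := fun x hx => (hX' x hx).2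
  have hXY : X' = Y := by
    ext x
    constructor
    · intro hx
      obtain ⟨⟨r, s⟩, hq, h1, h2⟩ := ex1 _ (hc' x hx)
      simp only at h1
      subst h1
      rw [hw' _ (hc' r hx), Nf_pos hx rfl, hTe _ hq] at h2
      have := (nextIn_mem hXb' (hXb' r hx)).1
      by_contra hn
      rw [Nf_neg (fun h => absurd h hn)] at h2
      omega
    · intro hx
      have h0 := hY.2.1 x hx
      have hcell : (x, α.parts x) ∈ α.cells :=
        mem_cells.2 ⟨by omega, parts_pos hs (by omega) (by omega), le_rfl⟩
      obtain ⟨⟨r, s⟩, hq, h1, h2⟩ := ex2 _ hcell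
      simp only at h1
      subst h1
      rw [hTe _ hcell, Nf_pos hx rfl, hw' _ hq] at h2
      have := (nextIn_mem hYb (hYb r hx)).1
      by_contra hn
      rw [Nf_neg (fun h => absurd h hn)] at h2
      omega
  rw [hXY] at haX' hX' hc' hw'
  have hNge : ∀ p ∈ α.cells, p.1 ≤ Nf X b α.parts p := fun p _ => Nf_ge hXb p
  obtain ⟨hXX, hcc⟩ := chain_compare ha hab hX hY (fun x hx => (hc' x hx).2.2) (by
    intro x hx i hxi hi
    have h0 := hX.2.1 x hx
    have hcell : (x, α.parts x) ∈ α.cells :=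
      mem_cells.2 ⟨by omega, parts_pos hs (by omega) (by omega), le_rfl⟩
    have e1 := col_split hge (α.parts x) i
    have e2 := col_split hNge (α.parts x) i
    have e3 : ((cellFinset α).filter (fun p => p.2 = α.parts x ∧ w p ≤ i)).card
        = ((cellFinset α).filter (fun p => p.2 = α.parts x ∧ Nf X b α.parts p ≤ i)).card := by
      rw [cc, card_cells t]
      simp only [hw, hπ]
    have e4 : 0 < ((cellFinset α).filter (fun p => p.2 = α.parts x ∧ p.1 ≤ i ∧
        i < Nf X b α.parts p)).card :=
      Finset.card_pos.2 ⟨(x, α.parts x), Finset.mem_filter.2 ⟨mem_cellFinset.2 hcell, rfl, hxi,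
        by rw [Nf_pos hx rfl]; exact hi⟩⟩
    have e5 : 0 < ((cellFinset α).filter (fun p => p.2 = α.parts x ∧ p.1 ≤ i ∧
        i < w p)).card := by omega
    obtain ⟨⟨r, s⟩, hq⟩ := Finset.card_pos.1 e5
    rw [Finset.mem_filter, mem_cellFinset] at hq
    obtain ⟨hq, h1, h2, h3⟩ := hq
    simp only at h1 h2
    rw [hw' _ hq] at h3
    by_cases h : r ∈ Y ∧ s = c' r
    · rw [Nf_pos h.1 h.2] at h3
      exact ⟨r, h.1, by rw [← h.2, h1], h2, h3⟩
    · rw [Nf_neg (fun h1 h2 => h ⟨h1, h2⟩)] at h3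
      omega)
  refine ⟨?_, hXX⟩
  have hfin : ∀ p ∈ α.cells, w p = Nf X b α.parts p := by
    intro p hp
    rw [hw' p hp, ← hXX, Nf_congr hcc]
  ext k
  have h1 : Nf X b α.parts (t.pos (π k)) = Nf X b α.parts (t.pos k) := by
    rw [← hfin _ (t.mem _), hw]
  have h2 := hπ k
  have m1 := t.mem (π k)
  have m2 := t.mem k
  have : t.pos (π k) = t.pos k := by
    rcases hA : t.pos (π k) with ⟨r, s⟩
    rcases hB : t.pos k with ⟨r', s'⟩
    rw [hA] at h1 h2 m1
    rw [hB] at h1 h2 m2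
    simp only at h2
    subst h2
    rcases lt_trichotomy r r' with h | h | h
    · have := Nf_col hs hX m1 m2 h
      omega
    · rw [h]
    · have := Nf_col hs hX m2 m1 h
      omega
  rw [t.inj this]
  rfl

variable {F : Type*} [Field F] {c : ℕ → ℕ}

open Classical in
lemma val_theta_single (T : ℕ × ℕ → ℕ) (x : Tabloid n α.parts) (r : F) (g : Fin n → ℕ) :
    val (theta F α c T (Finsupp.single x r)) g
      = if (∀ i, (Finset.univ.filter fun k => g k = i).card = c i) ∧
          (∀ i j, (Finset.univ.filter fun k => x.1 k = i ∧ g k = j).card = rowContent α T i j)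
        then r else 0 := by
  unfold theta
  rw [Finsupp.lift_apply, Finsupp.sum_single_index (by simp), val_smul, val_sum]
  simp only [val_single]
  split_ifs with h
  · rw [Finset.sum_eq_single (mkTab g h.1)]
    · rw [if_pos]
      · simp
      · rfl
    · intro y _ hy
      rw [if_neg]
      intro hg
      apply hy
      apply Subtype.ext
      exact hg.symm
    · intro hn
      exfalso
      apply hn
      rw [Finset.mem_filter]
      exact ⟨Finset.mem_univ _, h.2⟩
  · rw [Finset.sum_eq_zero, mul_zero]
    intro y hy
    rw [if_neg]
    intro hg
    apply h
    subst hg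
    exact ⟨y.2, (Finset.mem_filter.1 hy).2⟩

lemma theta_perm (T : ℕ × ℕ → ℕ) (π : Equiv.Perm (Fin n)) (v : PermMod F n α.parts) :
    theta F α c T (permM F α.parts π v) = permM F c π (theta F α c T v) := by
  classical
  induction v using Finsupp.induction_linear with
  | zero => simp
  | add v w hv hw => simp [hv, hw]
  | single x r =>
    apply val_ext
    intro g
    rw [val_permM, val_theta_single]
    unfold permM
    rw [Finsupp.lmapDomain_apply, Finsupp.mapDomain_single, val_theta_single]
    have e1 : ∀ i, (Finset.univ.filter fun k => (g ∘ π) k = i).card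
        = (Finset.univ.filter fun k => g k = i).card := content_perm g π
    have e2 : ∀ i j, (Finset.univ.filter fun k => x.1 k = i ∧ (g ∘ π) k = j).card
        = (Finset.univ.filter fun k => (permTabloid α.parts π x).1 k = i ∧ g k = j).card := by
      intro i j
      refine Finset.card_equiv π fun k => ?_
      rw [Finset.mem_filter, Finset.mem_filter]
      have : (permTabloid α.parts π x).1 (π k) = x.1 k := by
        change x.1 (π.symm (π k)) = _
        rw [Equiv.symm_apply_apply]
      rw [this]
      simp
    simp only [e1, e2]

lemma thetaHat_mem (T : ℕ × ℕ → ℕ) : thetaHat F α c T ∈ SpechtHom F α c ⊤ := by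
  refine ⟨fun _ => Submodule.mem_top, ?_⟩
  intro π x y h
  unfold thetaHat
  rw [LinearMap.comp_apply, LinearMap.comp_apply, Submodule.subtype_apply,
    Submodule.subtype_apply, h, theta_perm]

open Classical in
lemma Wof_thetaHat (t : Placement α) (T A : ℕ × ℕ → ℕ) (hA : IsTypeOf α c A) :
    Wof t (thetaHat F α c T) A = ∑ π ∈ colStab t,
      if (∀ i j, (Finset.univ.filter fun k => (t.pos (π k)).1 = i ∧ A (t.pos k) = j).card
        = rowContent α T i j) then ((Equiv.Perm.sign π : ℤ) : F) else 0 := by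
  unfold Wof thetaHat
  rw [LinearMap.comp_apply, Submodule.subtype_apply]
  change val (theta F α c T (polytabloid F t)) _ = _
  unfold polytabloid
  rw [map_sum, val_sum]
  refine Finset.sum_congr rfl fun π _ => ?_
  rw [map_smul, val_smul, val_theta_single]
  have h1 : ∀ i, (Finset.univ.filter fun k => A (t.pos k) = i).card = c i := by
    intro i
    rw [← hA i, card_cells t]
  rw [mul_ite, mul_one, mul_zero]
  refine if_congr ?_ rfl rfl
  exact ⟨fun h => h.2, fun h => ⟨h1, h⟩⟩

open Classical in
lemma delta (hs : OneBoxShift α β a b) {X Y : Finset ℕ} (hX : IsSSSet α a b X)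
    (hY : IsSSSet α a b Y) (t : Placement α) :
    Uw (Wof t (thetaHat F α β.parts (tableauOfSet α a b Y))) α b X = if X = Y then 1 else 0 := by
  unfold Uw
  rw [Wof_thetaHat t _ _ (Nf_type hs hX)]
  split_ifs with h
  · subst h
    rw [Finset.sum_eq_single 1]
    · rw [if_pos]
      · simp
      · intro i j
        rw [rowContent_eq, card_cells t]
        congr 1
        refine Finset.filter_congr fun k _ => ?_
        rw [tableauOfSet_eq hs hX _ (t.mem k)]
        rfl
    · intro π hπ hne
      rw [if_neg]
      intro hr
      exact hne (delta_aux hs hX hX t (mem_colStab.1 hπ) hr).1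
    · intro hn
      exact absurd (mem_colStab.2 fun k => rfl) hn
  · refine Finset.sum_eq_zero fun π hπ => ?_
    rw [if_neg]
    intro hr
    exact h (delta_aux hs hX hY t (mem_colStab.1 hπ) hr).2

lemma Wof_sub (t : Placement α) (f g : ↥(Specht F α) →ₗ[F] PermMod F n c) (r : F)
    (A : ℕ × ℕ → ℕ) : Wof t (f - r • g) A = Wof t f A - r * Wof t g A := by
  unfold Wof
  have : (f - r • g) (poly F t) = f (poly F t) + (-r) • g (poly F t) := by
    rw [LinearMap.sub_apply, LinearMap.smul_apply, neg_smul, sub_eq_add_neg]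
  rw [this, val_add, val_smul]
  ring

lemma Wof_comb (t : Placement α) {ι : Type*} (s : Finset ι) (r : ι → F)
    (g : ι → ↥(Specht F α) →ₗ[F] PermMod F n c) (A : ℕ × ℕ → ℕ) :
    Wof t (∑ i ∈ s, r i • g i) A = ∑ i ∈ s, r i * Wof t (g i) A := by
  unfold Wof
  rw [LinearMap.sum_apply, val_sum]
  refine Finset.sum_congr rfl fun i _ => ?_
  rw [LinearMap.smul_apply, val_smul]

lemma Uw_theta (hs : OneBoxShift α β a b) {X : Finset ℕ} (hX : IsSSSet α a b X)
    (t : Placement α) :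
    Uw (Wof t (∑ T ∈ sstFinset α β, ((cpCoeff α a b T : ℤ) : F) • thetaHat F α β.parts T)) α b X
      = (-1) ^ X.card * ∏ r ∈ Rset α a b \ X, (hook α b r : F) := by
  classical
  unfold Uw
  rw [Wof_comb, Finset.sum_eq_single (tableauOfSet α a b X)]
  · have h := delta (F := F) hs hX hX t
    unfold Uw at h
    rw [h, if_pos rfl, mul_one]
    unfold cpCoeff
    rw [Tset_tableauOfSet hs hX]
    push_cast
    rfl
  · intro T hT hne
    obtain ⟨Y, hY, rfl⟩ := sst_classify hs hT
    have h := delta (F := F) hs hX hY t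
    unfold Uw at h
    rw [h, if_neg, mul_zero]
    rintro rfl
    exact hne rfl
  · intro hn
    exact absurd (tableauOfSet_mem hs hX) hn

lemma sub_smul_aux (f g : ↥(Specht F α) →ₗ[F] PermMod F n c) (r : F) :
    f - r • g = f + (-r) • g := by
  apply LinearMap.ext
  intro x
  rw [LinearMap.sub_apply, LinearMap.add_apply, LinearMap.smul_apply, LinearMap.smul_apply,
    neg_smul, sub_eq_add_neg]

lemma hom_eq_smul (h2 : (2 : F) ≠ 0) (hs : OneBoxShift α β a b)
    {f : ↥(Specht F α) →ₗ[F] PermMod F n β.parts}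
    (hf : f ∈ SpechtHom F α β.parts (Specht F β)) :
    ∃ c : F, f = c • ∑ T ∈ sstFinset α β,
      ((cpCoeff α a b T : ℤ) : F) • thetaHat F α β.parts T := by
  rcases isEmpty_or_nonempty (Placement α) with he | ⟨⟨t⟩⟩
  · exact ⟨0, by rw [hom_eq_zero_of_isEmpty he f, zero_smul]⟩
  · have hΘ : (∑ T ∈ sstFinset α β, ((cpCoeff α a b T : ℤ) : F) • thetaHat F α β.parts T)
        ∈ SpechtHom F α β.parts ⊤ :=
      Submodule.sum_mem _ fun T _ => Submodule.smul_mem _ _ (thetaHat_mem T)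
    have hft : f ∈ SpechtHom F α β.parts ⊤ := ⟨fun _ => Submodule.mem_top, hf.2⟩
    obtain ⟨c, hc⟩ := rel_final (goodW_of_hom h2 hf t) (raiseW_of_hom hf t) hs
    refine ⟨c, ?_⟩
    have hd : f - c • (∑ T ∈ sstFinset α β,
        ((cpCoeff α a b T : ℤ) : F) • thetaHat F α β.parts T) ∈ SpechtHom F α β.parts ⊤ := by
      have h := Submodule.add_mem (SpechtHom F α β.parts ⊤) hft
        (Submodule.smul_mem (SpechtHom F α β.parts ⊤) (-c) hΘ)
      rwa [sub_smul_aux]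
    refine sub_eq_zero.1 (hom_eq_zero hd t ?_)
    refine W_zero (goodW_of_hom h2 hd t) rfl hs ?_
    intro X hX
    have e1 := hc X hX
    have e2 := Uw_theta (F := F) hs hX t
    unfold Uw at e1 e2 ⊢
    rw [Wof_sub, e1, e2, sub_self]

end Delta

/-- Let `F` be a field of characteristic `p > 2`, let `α` be a partition
of `n` and `β` a one-box-shift of `α` with `β_a = α_a - 1`, `β_b = α_b + 1`, `a < b`.
Then `Hom_{FΣ_n}(S^α, S^β)` has dimension at most one, and every non-zero
`FΣ_n`-homomorphism `S^α → S^β` is a scalar multiple of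
`Σ_T ((-1)^{|T|} ∏_{u ∈ {R}\{T}} h_u) θ̂_T`, the sum over all semistandard `α`-tableaux
`T` of type `β`. -/
theorem stmt16 (F : Type*) [Field F] (p : ℕ) [CharP F p] (hp : 2 < p)
    {n : ℕ} (α β : Partition n) (a b : ℕ) (hshift : OneBoxShift α β a b) :
    Module.rank F ↥(SpechtHom F α β.parts (Specht F β)) ≤ 1 ∧
    ∀ f ∈ SpechtHom F α β.parts (Specht F β), f ≠ 0 →
      ∃ c : F, f = c • ∑ T ∈ sstFinset α β, ((cpCoeff α a b T : ℤ) : F) • thetaHat F α β.parts T := by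
  have h2 : (2 : F) ≠ 0 := by
    intro h
    have h' : ((2 : ℕ) : F) = 0 := by exact_mod_cast h
    have := (CharP.cast_eq_zero_iff F p 2).1 h'
    have := Nat.le_of_dvd (by norm_num) this
    omega
  refine ⟨?_, fun f hf _ => hom_eq_smul h2 hshift hf⟩
  have hle : SpechtHom F α β.parts (Specht F β) ≤ Submodule.span F
      {∑ T ∈ sstFinset α β, ((cpCoeff α a b T : ℤ) : F) • thetaHat F α β.parts T} := by
    intro f hf
    obtain ⟨c, hc⟩ := hom_eq_smul h2 hshift hf
    exact Submodule.mem_span_singleton.2 ⟨c, hc.symm⟩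
  refine (Submodule.rank_mono hle).trans ((rank_span_le _).trans ?_)
  rw [Cardinal.mk_singleton]

end CarterPayne
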